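/- Let p ∈ (1,∞), n ≥ 2, k ∈ {1,…,n−1}, and −∞ < a_i < b_i < ∞ for i = 1,…,n−k; set D = ℝ^k × ∏_{i=1}^{n−k}(a_i,b_i) ⊆ ℝⁿ, and let I_p denote the canonical embedding W_0^{1,p}(D) ↪ L^p(D). Then I_p is maximally noncompact and its measure of noncompactness equals β(I_p) = ‖I_p‖ = (1 + (p−1)(2π/(p sin(π/p)))^p Σ_{i=1}^{n−k} (b_i−a_i)^{−p})^{−1/p}. -/

import Mathlib

open MeasureTheory ENNReal Set Filter Topology

noncomputable section

/-- The `i`-th partial derivative of `u : ℝⁿ → ℝ`. -/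
def pder {n : ℕ} (i : Fin n) (u : (Fin n → ℝ) → ℝ) (x : Fin n → ℝ) : ℝ :=
  fderiv ℝ u x (Pi.single i 1)

/-- `u` is a smooth function compactly supported in the open set `D`. -/
def IsTestFun {n : ℕ} (D : Set (Fin n → ℝ)) (u : (Fin n → ℝ) → ℝ) : Prop :=
  ContDiff ℝ (⊤ : ℕ∞) u ∧ HasCompactSupport u ∧ tsupport u ⊆ D

/-- The strip-like domain `ℝᵏ × ∏_{i ≥ k} (aᵢ, bᵢ)`, realized as a subset of `ℝⁿ`:
the coordinates `i < k` are free, the coordinates `i ≥ k` are constrained to `(aᵢ, bᵢ)`. -/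
def stripDomain (n k : ℕ) (a b : Fin n → ℝ) : Set (Fin n → ℝ) :=
  {x | ∀ i : Fin n, k ≤ (i : ℕ) → x i ∈ Set.Ioo (a i) (b i)}

/-- The ambient space `V = L^p(ℝⁿ; ℓ^p(ℝ^{n+1}))`, in which the Sobolev space `W^{1,p}_0`
is realized as the closure of the set of "jets" `(u, ∇u)` of test functions. -/
abbrev Vsp (n : ℕ) (p : ℝ≥0∞) [Fact (1 ≤ p)] :=
  Lp (PiLp p (fun _ : Fin (n + 1) => ℝ)) p (volume : Measure (Fin n → ℝ))

/-- The "jet" `(u, ∂₁u, …, ∂ₙu)` of a function, valued in `ℓ^p(ℝ^{n+1})`. -/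
def jet {n : ℕ} (p : ℝ≥0∞) (u : (Fin n → ℝ) → ℝ) (x : Fin n → ℝ) :
    PiLp p (fun _ : Fin (n + 1) => ℝ) :=
  (WithLp.equiv p (∀ _ : Fin (n + 1), ℝ)).symm (Fin.cons (u x) (fun i => pder i u x))

/-- `W^{1,p}_0(D)` realized as a closed subspace of `V`:
the closure of the subspace of jets of test functions supported in `D`.
The (subspace) norm of the jet of `u` is exactly
`(‖u‖_p^p + ‖ |∇u|_{ℓ^p} ‖_p^p)^{1/p}`, i.e., the `W^{1,p}`-norm of `u`. -/
def W0sub {n : ℕ} (p : ℝ≥0∞) [Fact (1 ≤ p)] (D : Set (Fin n → ℝ)) : Submodule ℝ (Vsp n p) :=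
  (Submodule.span ℝ {f : Vsp n p | ∃ u : (Fin n → ℝ) → ℝ, IsTestFun D u ∧
    (f : (Fin n → ℝ) → PiLp p (fun _ : Fin (n + 1) => ℝ)) =ᵐ[volume] jet p u}).topologicalClosure

instance W0sub.completeSpace {n : ℕ} (p : ℝ≥0∞) [Fact (1 ≤ p)] (D : Set (Fin n → ℝ)) :
    CompleteSpace (W0sub (n := n) p D) :=
  (Submodule.isClosed_topologicalClosure _).completeSpace_coe

/-- Projection of a jet onto its zeroth (function) component. -/
def proj0 (n : ℕ) (p : ℝ≥0∞) [Fact (1 ≤ p)] : PiLp p (fun _ : Fin (n + 1) => ℝ) →L[ℝ] ℝ :=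
  (ContinuousLinearMap.proj (0 : Fin (n + 1))).comp
    (PiLp.continuousLinearEquiv p ℝ (fun _ : Fin (n + 1) => ℝ)).toContinuousLinearMap

/-- Projection of a jet onto its gradient components, valued in `ℓ^p(ℝⁿ)`. -/
def projGrad (n : ℕ) (p : ℝ≥0∞) [Fact (1 ≤ p)] :
    PiLp p (fun _ : Fin (n + 1) => ℝ) →L[ℝ] PiLp p (fun _ : Fin n => ℝ) :=
  ((PiLp.continuousLinearEquiv p ℝ (fun _ : Fin n => ℝ)).symm.toContinuousLinearMap).comp
    ((ContinuousLinearMap.pi fun i : Fin n => ContinuousLinearMap.proj (R := ℝ) i.succ).comp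
      (PiLp.continuousLinearEquiv p ℝ (fun _ : Fin (n + 1) => ℝ)).toContinuousLinearMap)

/-- The canonical Sobolev embedding `I : W^{1,p}_0(D) → L^p(D)` (as a map into `L^p(ℝⁿ)`;
all functions in `W^{1,p}_0(D)` vanish a.e. outside `D`). -/
def SobolevEmb {n : ℕ} (p : ℝ≥0∞) [Fact (1 ≤ p)] (D : Set (Fin n → ℝ)) :
    W0sub (n := n) p D →L[ℝ] Lp ℝ p (volume : Measure (Fin n → ℝ)) :=
  ((proj0 n p).compLpL p volume).comp (W0sub p D).subtypeL

/-- The gradient map `W^{1,p}_0(D) → L^p(D; ℓ^p(ℝⁿ))`, `u ↦ ∇u`. -/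
def SobolevGrad {n : ℕ} (p : ℝ≥0∞) [Fact (1 ≤ p)] (D : Set (Fin n → ℝ)) :
    W0sub (n := n) p D →L[ℝ] Lp (PiLp p (fun _ : Fin n => ℝ)) p (volume : Measure (Fin n → ℝ)) :=
  ((projGrad n p).compLpL p volume).comp (W0sub p D).subtypeL

/-- `π_p = 2 ∫₀¹ (1 - sᵖ)^{-1/p} ds`. -/
def piP (p : ℝ) : ℝ := 2 * ∫ s in (0 : ℝ)..1, (1 - s ^ p) ^ (-1 / p)

/-- The inverse of `t ↦ ∫₀ᵗ (1 - sᵖ)^{-1/p} ds` on `[0,1]`; this is `sin_p` on `[0, π_p/2]`. -/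
def sinpHalf (p : ℝ) : ℝ → ℝ :=
  Function.invFunOn (fun t : ℝ => ∫ s in (0 : ℝ)..t, (1 - s ^ p) ^ (-1 / p)) (Set.Icc 0 1)

/-- `sin_p` on `[0, π_p]`, by reflection around `π_p/2`. -/
def sinpBase (p t : ℝ) : ℝ :=
  if t ≤ piP p / 2 then sinpHalf p t else sinpHalf p (piP p - t)

/-- `sin_p` on `[-π_p, π_p]`, by odd reflection. -/
def sinpSym (p t : ℝ) : ℝ := if 0 ≤ t then sinpBase p t else -sinpBase p (-t)

/-- The generalized sine function `sin_p`, extended `2π_p`-periodically to all of `ℝ`. -/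
def sinp (p t : ℝ) : ℝ :=
  sinpSym p (t - 2 * piP p * ⌊(t + piP p) / (2 * piP p)⌋)

/-- The generalized cosine function `cos_p = (sin_p)'`. -/
def cosp (p : ℝ) : ℝ → ℝ := deriv (sinp p)

/-- The `m`-th entropy number of a bounded linear operator: the infimum of all `ε > 0` such
that the image of the closed unit ball can be covered by `2^{m-1}` balls of radius `ε`. -/
def entropyNumber {X Y : Type*} [NormedAddCommGroup X] [NormedSpace ℝ X]
    [NormedAddCommGroup Y] [NormedSpace ℝ Y] (m : ℕ) (T : X →L[ℝ] Y) : ℝ :=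
  sInf {ε : ℝ | 0 < ε ∧ ∃ c : Fin (2 ^ (m - 1)) → Y,
    ∀ x : X, ‖x‖ ≤ 1 → ∃ j, ‖T x - c j‖ ≤ ε}

end

theorem image_rpow_div_one_add_rpow {q : ℝ} (hq : 0 < q) :
    (fun v : ℝ => v ^ q / (1 + v ^ q)) '' Ioi 0 = Ioo 0 1 := by
  ext x
  constructor
  · rintro ⟨v, hv, rfl⟩
    have hv' : 0 < v ^ q := Real.rpow_pos_of_pos hv q
    exact ⟨by positivity, by rw [div_lt_one (by positivity)]; linarith⟩
  · rintro ⟨h0, h1⟩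
    have h1' : 0 < 1 - x := by linarith
    refine ⟨(x / (1 - x)) ^ (1 / q), Real.rpow_pos_of_pos (by positivity) _, ?_⟩
    have : ((x / (1 - x)) ^ (1 / q)) ^ q = x / (1 - x) := by
      rw [← Real.rpow_mul (by positivity), one_div_mul_cancel hq.ne', Real.rpow_one]
    simp only [this]
    have hne : 1 - x ≠ 0 := h1'.ne'
    rw [div_eq_iff (by positivity)]
    field_simp
    ring

theorem hasDerivAt_rpow_div_one_add_rpow (q : ℝ) {v : ℝ} (hv : 0 < v) :
    HasDerivAt (fun v : ℝ => v ^ q / (1 + v ^ q)) (q * v ^ (q - 1) / (1 + v ^ q) ^ 2) v := by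
  have h := Real.hasDerivAt_rpow_const (x := v) (p := q) (Or.inl hv.ne')
  have hv' : 0 < v ^ q := Real.rpow_pos_of_pos hv q
  exact (h.div (h.const_add 1) (by positivity)).congr_deriv (by ring)

theorem injOn_rpow_div_one_add_rpow {q : ℝ} (hq : 0 < q) :
    InjOn (fun v : ℝ => v ^ q / (1 + v ^ q)) (Ioi 0) := by
  intro v hv w hw h
  have hv' : 0 < v ^ q := Real.rpow_pos_of_pos hv q
  have hw' : 0 < w ^ q := Real.rpow_pos_of_pos hw q
  simp only at h
  rw [div_eq_div_iff (by positivity) (by positivity)] at h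
  have h2 : v ^ q = w ^ q := by linarith
  exact Real.rpow_left_injOn hq.ne' (mem_Ioi.1 hv).le (mem_Ioi.1 hw).le h2

theorem lintegral_inv_one_add_rpow {q : ℝ} (hq : 1 < q) :
    ∫⁻ v in Ioi (0 : ℝ), ENNReal.ofReal (1 + v ^ q)⁻¹ =
      ENNReal.ofReal (Real.pi / q / Real.sin (Real.pi / q)) := by
  have hq0 : 0 < q := by linarith
  have hα : 0 < 1 / q := by positivity
  have hβ : 0 < 1 - 1 / q := by
    rw [sub_pos, div_lt_one hq0]; exact hq
  have hB : ProbabilityTheory.beta (1 / q) (1 - 1 / q) = Real.pi / Real.sin (Real.pi / q) := by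
    rw [ProbabilityTheory.beta, Real.Gamma_mul_Gamma_one_sub]
    simp [div_eq_mul_inv]
  have hBpos := ProbabilityTheory.beta_pos hα hβ
  have h := ProbabilityTheory.lintegral_betaPDF_eq_one hα hβ
  set B := ProbabilityTheory.beta (1 / q) (1 - 1 / q) with hBdef
  rw [ProbabilityTheory.lintegral_betaPDF, ← image_rpow_div_one_add_rpow hq0,
    lintegral_image_eq_lintegral_abs_deriv_mul measurableSet_Ioi
      (fun v hv => (hasDerivAt_rpow_div_one_add_rpow q hv).hasDerivWithinAt)
      (injOn_rpow_div_one_add_rpow hq0), ← hBdef] at h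
  have h2 : ∀ v ∈ Ioi (0 : ℝ), ENNReal.ofReal |q * v ^ (q - 1) / (1 + v ^ q) ^ 2| *
      ENNReal.ofReal (1 / B * (v ^ q / (1 + v ^ q)) ^ (1 / q - 1) *
        (1 - v ^ q / (1 + v ^ q)) ^ (1 - 1 / q - 1)) =
      ENNReal.ofReal (q / B) * ENNReal.ofReal (1 + v ^ q)⁻¹ := by
    intro v hv
    have hv0 : 0 < v := hv
    have hv' : 0 < v ^ q := Real.rpow_pos_of_pos hv q
    have hD : 0 < 1 + v ^ q := by positivity
    rw [← ENNReal.ofReal_mul (abs_nonneg _), ← ENNReal.ofReal_mul (by positivity)]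
    congr 1
    have e1 : (1 - v ^ q / (1 + v ^ q)) = (1 + v ^ q)⁻¹ := by field_simp; ring
    have e2 : |q * v ^ (q - 1) / (1 + v ^ q) ^ 2| = q * v ^ (q - 1) / (1 + v ^ q) ^ 2 :=
      abs_of_nonneg (by positivity)
    have e3 : (1 + v ^ q)⁻¹ ^ (1 - 1 / q - 1) = (1 + v ^ q) ^ (1 / q) := by
      rw [Real.inv_rpow hD.le, ← Real.rpow_neg hD.le]; congr 1; ring
    have e4 : (v ^ q / (1 + v ^ q)) ^ (1 / q - 1) = v ^ (1 - q) * (1 + v ^ q) ^ (1 - 1 / q) := by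
      rw [Real.div_rpow hv'.le hD.le, ← Real.rpow_mul hv0.le, div_eq_mul_inv,
        ← Real.rpow_neg hD.le]
      congr 2
      · field_simp
      · ring
    have e5 : v ^ (q - 1) * v ^ (1 - q) = 1 := by
      rw [← Real.rpow_add hv0]; simp
    have e6 : (1 + v ^ q) ^ (1 - 1 / q) * (1 + v ^ q) ^ (1 / q) = 1 + v ^ q := by
      rw [← Real.rpow_add hD]; simp
    rw [e1, e2, e3, e4]
    calc _ = q / B / (1 + v ^ q) ^ 2 * (v ^ (q - 1) * v ^ (1 - q)) *
          ((1 + v ^ q) ^ (1 - 1 / q) * (1 + v ^ q) ^ (1 / q)) := by ring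
      _ = _ := by rw [e5, e6]; field_simp
  rw [setLIntegral_congr_fun measurableSet_Ioi h2, lintegral_const_mul' _ _ (by simp)] at h
  have hc : Real.pi / q / Real.sin (Real.pi / q) = B / q := by rw [hB]; ring
  rw [hc]
  have h3 : ENNReal.ofReal (B / q) * ENNReal.ofReal (q / B) = 1 := by
    rw [← ENNReal.ofReal_mul (by positivity)]
    simp [hBpos.ne', hq0.ne']
  calc _ = ENNReal.ofReal (B / q) * ENNReal.ofReal (q / B) *
      ∫⁻ v in Ioi (0 : ℝ), ENNReal.ofReal (1 + v ^ q)⁻¹ := by rw [h3, one_mul]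
    _ = _ := by rw [mul_assoc, h, mul_one]

theorem sin_pi_div_pos {q : ℝ} (hq : 1 < q) : 0 < Real.sin (Real.pi / q) := by
  have := Real.pi_pos
  refine Real.sin_pos_of_pos_of_lt_pi (by positivity) ?_
  rw [div_lt_iff₀ (by linarith)]
  nlinarith

theorem integrableOn_inv_one_add_abs_rpow {q : ℝ} (hq : 1 < q) :
    IntegrableOn (fun v : ℝ => (1 + |v| ^ q)⁻¹) (Ioi 0) := by
  have hm : Measurable (fun v : ℝ => (1 + |v| ^ q)⁻¹) := by fun_prop
  refine (lintegral_ofReal_ne_top_iff_integrable hm.aestronglyMeasurable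
    (Eventually.of_forall fun v => by positivity)).1 ?_
  rw [setLIntegral_congr_fun (g := fun v => ENNReal.ofReal (1 + v ^ q)⁻¹) measurableSet_Ioi
    (fun v hv => by simp only [abs_of_pos (show (0 : ℝ) < v from hv)]),
    lintegral_inv_one_add_rpow hq]
  simp

theorem integral_inv_one_add_abs_rpow {q : ℝ} (hq : 1 < q) :
    ∫ v in Ioi (0 : ℝ), (1 + |v| ^ q)⁻¹ = Real.pi / q / Real.sin (Real.pi / q) := by
  have hm : Measurable (fun v : ℝ => (1 + |v| ^ q)⁻¹) := by fun_prop
  have := sin_pi_div_pos hq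
  have := Real.pi_pos
  rw [integral_eq_lintegral_of_nonneg_ae (Eventually.of_forall fun v => by positivity)
    hm.aestronglyMeasurable,
    setLIntegral_congr_fun (g := fun v => ENNReal.ofReal (1 + v ^ q)⁻¹) measurableSet_Ioi
    (fun v hv => by simp only [abs_of_pos (show (0 : ℝ) < v from hv)]),
    lintegral_inv_one_add_rpow hq, ENNReal.toReal_ofReal (by positivity)]

/-- The generalized arctangent `v ↦ ∫₀ᵛ ds / (1 + |s|^q)`. -/
noncomputable def genArctan (q v : ℝ) : ℝ := ∫ s in (0 : ℝ)..v, (1 + |s| ^ q)⁻¹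

/-- The limit of the generalized arctangent at infinity. -/
noncomputable def genHalfPi (q : ℝ) : ℝ := Real.pi / q / Real.sin (Real.pi / q)

/-- The generalized tangent, a left inverse of the generalized arctangent. -/
noncomputable def genTan (q : ℝ) : ℝ → ℝ := Function.invFun (genArctan q)

theorem genHalfPi_pos {q : ℝ} (hq : 1 < q) : 0 < genHalfPi q := by
  have := sin_pi_div_pos hq
  have := Real.pi_pos
  unfold genHalfPi
  positivity

theorem continuous_inv_one_add_abs_rpow {q : ℝ} (hq : 0 < q) :
    Continuous (fun v : ℝ => (1 + |v| ^ q)⁻¹) := by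
  have : Continuous (fun v : ℝ => |v| ^ q) := continuous_abs.rpow_const fun _ => Or.inr hq.le
  exact (continuous_const.add this).inv₀ fun v => show 1 + |v| ^ q ≠ 0 by positivity

theorem hasStrictDerivAt_genArctan {q : ℝ} (hq : 0 < q) (v : ℝ) :
    HasStrictDerivAt (genArctan q) (1 + |v| ^ q)⁻¹ v := by
  have hc := continuous_inv_one_add_abs_rpow hq
  exact intervalIntegral.integral_hasStrictDerivAt_right (hc.intervalIntegrable _ _)
    (hc.stronglyMeasurableAtFilter _ _) hc.continuousAt

theorem strictMono_genArctan {q : ℝ} (hq : 0 < q) : StrictMono (genArctan q) :=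
  strictMono_of_hasDerivAt_pos (f' := fun v => (1 + |v| ^ q)⁻¹) (fun v => (hasStrictDerivAt_genArctan hq v).hasDerivAt)
    fun v => by positivity

theorem genArctan_neg (q v : ℝ) : genArctan q (-v) = -genArctan q v := by
  unfold genArctan
  have := intervalIntegral.integral_comp_neg (a := 0) (b := v) (fun s : ℝ => (1 + |s| ^ q)⁻¹)
  simp only [abs_neg, neg_zero] at this
  rw [this, intervalIntegral.integral_symm]

theorem tendsto_genArctan {q : ℝ} (hq : 1 < q) :
    Tendsto (genArctan q) atTop (𝓝 (genHalfPi q)) := by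
  have := intervalIntegral_tendsto_integral_Ioi 0 (integrableOn_inv_one_add_abs_rpow hq) tendsto_id
  rwa [integral_inv_one_add_abs_rpow hq] at this

theorem genArctan_lt {q : ℝ} (hq : 1 < q) (v : ℝ) : genArctan q v < genHalfPi q := by
  have hm := strictMono_genArctan (q := q) (by linarith)
  exact (hm (lt_add_one v)).trans_le (hm.monotone.ge_of_tendsto (tendsto_genArctan hq) _)

theorem neg_lt_genArctan {q : ℝ} (hq : 1 < q) (v : ℝ) : -genHalfPi q < genArctan q v := by
  have := genArctan_lt hq (-v)
  rw [genArctan_neg] at this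
  linarith

theorem genTan_genArctan {q : ℝ} (hq : 0 < q) (v : ℝ) : genTan q (genArctan q v) = v :=
  Function.leftInverse_invFun (strictMono_genArctan hq).injective v

theorem exists_genArctan_eq {q : ℝ} (hq : 1 < q) {t : ℝ}
    (ht : t ∈ Ioo (-genHalfPi q) (genHalfPi q)) : ∃ v, genArctan q v = t := by
  have hc : Continuous (genArctan q) := continuous_iff_continuousAt.2 fun v =>
    (hasStrictDerivAt_genArctan (by linarith) v).hasDerivAt.continuousAt
  obtain ⟨M, hM⟩ := ((tendsto_genArctan hq).eventually (lt_mem_nhds ht.2)).exists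
  obtain ⟨N, hN⟩ := ((tendsto_genArctan hq).eventually
    (lt_mem_nhds (show -t < genHalfPi q by linarith [ht.1]))).exists
  exact mem_range_of_exists_le_of_exists_ge hc ⟨-N, by rw [genArctan_neg]; linarith⟩ ⟨M, hM.le⟩

theorem hasDerivAt_genTan {q : ℝ} (hq : 1 < q) {t : ℝ}
    (ht : t ∈ Ioo (-genHalfPi q) (genHalfPi q)) :
    HasDerivAt (genTan q) (1 + |genTan q t| ^ q) t := by
  have hq0 : 0 < q := by linarith
  obtain ⟨v, rfl⟩ := exists_genArctan_eq hq ht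
  have := (hasStrictDerivAt_genArctan hq0 v).to_local_left_inverse
    (by positivity) (Eventually.of_forall (genTan_genArctan hq0))
  rw [inv_inv] at this
  rw [genTan_genArctan hq0]
  exact this.hasDerivAt

/-- The composition of `F` with the generalized tangent, extended by zero to the real line. -/
noncomputable def genTanExt (q : ℝ) (F : ℝ → ℝ) : ℝ → ℝ :=
  (Ioo (-genHalfPi q) (genHalfPi q)).indicator (fun t => F (genTan q t))

theorem genTanExt_of_mem {q : ℝ} (F : ℝ → ℝ) {t : ℝ}
    (ht : t ∈ Ioo (-genHalfPi q) (genHalfPi q)) : genTanExt q F t = F (genTan q t) :=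
  indicator_of_mem ht _

theorem genTanExt_of_notMem {q : ℝ} (F : ℝ → ℝ) {t : ℝ}
    (ht : t ∉ Ioo (-genHalfPi q) (genHalfPi q)) : genTanExt q F t = 0 :=
  indicator_of_notMem ht _

theorem genTanExt_eventuallyEq {q : ℝ} (F : ℝ → ℝ) {t : ℝ}
    (ht : t ∈ Ioo (-genHalfPi q) (genHalfPi q)) :
    genTanExt q F =ᶠ[𝓝 t] fun t => F (genTan q t) := by
  filter_upwards [isOpen_Ioo.mem_nhds ht] with s hs using genTanExt_of_mem F hs

theorem continuous_genTanExt {q : ℝ} (hq : 1 < q) {F : ℝ → ℝ} (hF : Continuous F)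
    (h0 : Tendsto F (cocompact ℝ) (𝓝 0)) : Continuous (genTanExt q F) := by
  have hq0 : 0 < q := by linarith
  refine continuous_iff_continuousAt.2 fun t => ?_
  by_cases ht : t ∈ Ioo (-genHalfPi q) (genHalfPi q)
  · exact (hF.continuousAt.comp (hasDerivAt_genTan hq ht).continuousAt).congr
      (genTanExt_eventuallyEq F ht).symm
  · rw [ContinuousAt, genTanExt_of_notMem F ht, Metric.tendsto_nhds]
    intro ε hε
    obtain ⟨K, hK, hKF⟩ := mem_cocompact.1 (h0.eventually (Metric.ball_mem_nhds 0 hε))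
    have hc : Continuous (genArctan q) := continuous_iff_continuousAt.2 fun v =>
      (hasStrictDerivAt_genArctan hq0 v).hasDerivAt.continuousAt
    have htK : t ∉ genArctan q '' K := by
      rintro ⟨v, -, rfl⟩
      exact ht ⟨neg_lt_genArctan hq v, genArctan_lt hq v⟩
    filter_upwards [(hK.image hc).isClosed.isOpen_compl.mem_nhds htK] with s hs
    by_cases hs' : s ∈ Ioo (-genHalfPi q) (genHalfPi q)
    · obtain ⟨v, rfl⟩ := exists_genArctan_eq hq hs'
      rw [genTanExt_of_mem F hs', genTan_genArctan hq0]
      exact hKF fun hv => hs ⟨v, hv, rfl⟩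
    · rw [genTanExt_of_notMem F hs']
      simpa using hε

theorem hasCompactSupport_genTanExt (q : ℝ) (F : ℝ → ℝ) : HasCompactSupport (genTanExt q F) :=
  HasCompactSupport.intro (isCompact_Icc (a := -genHalfPi q) (b := genHalfPi q))
    fun _ ht => genTanExt_of_notMem F fun h => ht ⟨h.1.le, h.2.le⟩

theorem hasDerivAt_genTanExt {q : ℝ} (hq : 1 < q) {F F' : ℝ → ℝ}
    (hF : ∀ v, HasDerivAt F (F' v) v) (h0 : Tendsto F (cocompact ℝ) (𝓝 0))
    (hG : Continuous fun v => F' v * (1 + |v| ^ q))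
    (hG0 : Tendsto (fun v => F' v * (1 + |v| ^ q)) (cocompact ℝ) (𝓝 0)) (t : ℝ) :
    HasDerivAt (genTanExt q F) (genTanExt q (fun v => F' v * (1 + |v| ^ q)) t) t := by
  have hcF : Continuous F := continuous_iff_continuousAt.2 fun v => (hF v).continuousAt
  have hc := continuous_genTanExt hq hcF h0
  have hcG := continuous_genTanExt hq hG hG0
  have key : ∀ t, ∫ s in (0 : ℝ)..t, genTanExt q (fun v => F' v * (1 + |v| ^ q)) s =
      genTanExt q F t - genTanExt q F 0 := by
    intro t
    refine integral_eq_of_hasDerivAt_off_countable _ _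
      (Set.toFinite {-genHalfPi q, genHalfPi q}).countable hc.continuousOn ?_
      (hcG.intervalIntegrable _ _)
    rintro s ⟨-, hs⟩
    simp only [mem_insert_iff, mem_singleton_iff, not_or] at hs
    by_cases hs' : s ∈ Ioo (-genHalfPi q) (genHalfPi q)
    · rw [genTanExt_of_mem _ hs']
      exact ((hF _).comp s (hasDerivAt_genTan hq hs')).congr_of_eventuallyEq
        (genTanExt_eventuallyEq F hs')
    · rw [genTanExt_of_notMem _ hs']
      have hs2 : s ∈ (Icc (-genHalfPi q) (genHalfPi q))ᶜ := fun h =>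
        hs' ⟨lt_of_le_of_ne h.1 (Ne.symm hs.1), lt_of_le_of_ne h.2 hs.2⟩
      refine (hasDerivAt_const s (0 : ℝ)).congr_of_eventuallyEq ?_
      filter_upwards [isClosed_Icc.isOpen_compl.mem_nhds hs2] with r hr
      exact genTanExt_of_notMem F fun h => hr ⟨h.1.le, h.2.le⟩
  have h2 := ((hcG.integral_hasStrictDerivAt 0 t).hasDerivAt).add_const (genTanExt q F 0)
  refine h2.congr_of_eventuallyEq (Eventually.of_forall fun s => ?_)
  simp only [key]
  ring

theorem integral_genTanExt_deriv_eq_zero {q : ℝ} (hq : 1 < q) {F F' : ℝ → ℝ}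
    (hF : ∀ v, HasDerivAt F (F' v) v) (h0 : Tendsto F (cocompact ℝ) (𝓝 0))
    (hG : Continuous fun v => F' v * (1 + |v| ^ q))
    (hG0 : Tendsto (fun v => F' v * (1 + |v| ^ q)) (cocompact ℝ) (𝓝 0)) :
    ∫ t, genTanExt q (fun v => F' v * (1 + |v| ^ q)) t = 0 := by
  have hcF : Continuous F := continuous_iff_continuousAt.2 fun v => (hF v).continuousAt
  exact integral_eq_zero_of_hasDerivAt_of_integrable (hasDerivAt_genTanExt hq hF h0 hG hG0)
    ((continuous_genTanExt hq hG hG0).integrable_of_hasCompactSupport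
      (hasCompactSupport_genTanExt _ _))
    ((continuous_genTanExt hq hcF h0).integrable_of_hasCompactSupport
      (hasCompactSupport_genTanExt _ _))

theorem tendsto_one_add_abs_rpow_neg {q γ : ℝ} (hq : 0 < q) (hγ : γ < 0) :
    Tendsto (fun v : ℝ => (1 + |v| ^ q) ^ γ) (cocompact ℝ) (𝓝 0) := by
  have h1 : Tendsto (fun v : ℝ => 1 + |v| ^ q) (cocompact ℝ) atTop :=
    tendsto_atTop_add_const_left _ _
      ((tendsto_rpow_atTop hq).comp (tendsto_norm_cocompact_atTop (E := ℝ)))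
  have := (tendsto_rpow_neg_atTop (neg_pos.2 hγ)).comp h1
  rw [neg_neg] at this
  exact this

theorem continuous_abs_rpow_mul {q : ℝ} (hq : 1 < q) :
    Continuous (fun v : ℝ => |v| ^ (q - 2) * v) := by
  have h := ((contDiff_norm_rpow (E := ℝ) hq).continuous_deriv le_rfl).const_smul (q⁻¹)
  convert h using 2 with v
  have := (hasDerivAt_norm_rpow v hq).deriv
  have hq0 : q ≠ 0 := by linarith
  rw [Pi.smul_apply, this, Real.norm_eq_abs, smul_eq_mul]
  field_simp

theorem continuous_one_add_abs_rpow_rpow {q : ℝ} (hq : 0 < q) (γ : ℝ) :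
    Continuous (fun v : ℝ => (1 + |v| ^ q) ^ γ) := by
  have : Continuous (fun v : ℝ => |v| ^ q) := continuous_abs.rpow_const fun _ => Or.inr hq.le
  exact (continuous_const.add this).rpow_const fun v => Or.inl (show 1 + |v| ^ q ≠ 0 by positivity)

theorem hasDerivAt_one_add_abs_rpow_rpow {q : ℝ} (hq : 1 < q) (γ v : ℝ) :
    HasDerivAt (fun v : ℝ => (1 + |v| ^ q) ^ γ)
      (γ * q * (|v| ^ (q - 2) * v) * (1 + |v| ^ q) ^ (γ - 1)) v := by
  have h := ((hasDerivAt_abs_rpow v hq).const_add 1).rpow_const (p := γ)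
    (Or.inl (show 1 + |v| ^ q ≠ 0 by positivity))
  exact h.congr_deriv (by ring)

theorem abs_abs_rpow_mul {q : ℝ} (hq : 1 < q) (v : ℝ) :
    |(|v| ^ (q - 2) * v)| = |v| ^ (q - 1) := by
  rw [abs_mul, abs_of_nonneg (by positivity)]
  rcases eq_or_ne v 0 with rfl | hv
  · simp [Real.zero_rpow (show q - 1 ≠ 0 by linarith)]
  · rw [← Real.rpow_add_one (by positivity)]
    congr 1
    ring

theorem abs_rpow_le_one_add_abs_rpow {q r : ℝ} (hq : 0 < q) (hr : 0 ≤ r) (v : ℝ) :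
    |v| ^ r ≤ (1 + |v| ^ q) ^ (r / q) := by
  calc |v| ^ r = (|v| ^ q) ^ (r / q) := by
        rw [← Real.rpow_mul (abs_nonneg v)]
        congr 1
        field_simp
    _ ≤ _ := by
        apply Real.rpow_le_rpow (by positivity) _ (by positivity)
        linarith

/-- Energy identity for the functions `(1 + |tan_q|^q)^{-s/p}`. -/
theorem integral_genTanExt_energy {q s : ℝ} (hq : 1 < q) (hs : 1 < s) :
    (s * q - 1) * ∫ t, genTanExt q (fun v => |v| ^ q * (1 + |v| ^ q) ^ (-s)) t =
      ∫ t, genTanExt q (fun v => (1 + |v| ^ q) ^ (-s)) t := by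
  have hq0 : 0 < q := by linarith
  have hA : ∀ v : ℝ, 0 < 1 + |v| ^ q := fun v => by positivity
  have hvq : ∀ v : ℝ, |v| ^ (q - 2) * v * v = |v| ^ q := by
    intro v
    rcases eq_or_ne v 0 with rfl | hv
    · simp [Real.zero_rpow hq0.ne']
    · rw [mul_assoc, ← sq, ← sq_abs, ← Real.rpow_natCast, ← Real.rpow_add (by positivity)]
      norm_num
  have hcq : Continuous (fun v : ℝ => |v| ^ q) := continuous_abs.rpow_const fun _ => Or.inr hq0.le
  have hcA := continuous_one_add_abs_rpow_rpow hq0 (-s)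
  have hd : ∀ v : ℝ, HasDerivAt (fun v : ℝ => v * (1 + |v| ^ q) ^ (-s))
      ((1 + |v| ^ q) ^ (-s) + v * (-s * q * (|v| ^ (q - 2) * v) * (1 + |v| ^ q) ^ (-s - 1))) v := by
    intro v
    exact ((hasDerivAt_id v).mul (hasDerivAt_one_add_abs_rpow_rpow hq (-s) v)).congr_deriv
      (by simp)
  have hG : (fun v : ℝ => ((1 + |v| ^ q) ^ (-s) +
      v * (-s * q * (|v| ^ (q - 2) * v) * (1 + |v| ^ q) ^ (-s - 1))) * (1 + |v| ^ q)) =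
      fun v => (1 + |v| ^ q) ^ (-s) - (s * q - 1) * (|v| ^ q * (1 + |v| ^ q) ^ (-s)) := by
    ext v
    have e : (1 + |v| ^ q) ^ (-s - 1) * (1 + |v| ^ q) = (1 + |v| ^ q) ^ (-s) := by
      rw [← Real.rpow_add_one (hA v).ne']; congr 1; ring
    calc _ = (1 + |v| ^ q) ^ (-s) * (1 + |v| ^ q) - s * q * (|v| ^ (q - 2) * v * v) *
          ((1 + |v| ^ q) ^ (-s - 1) * (1 + |v| ^ q)) := by ring
      _ = _ := by rw [e, hvq]; ring
  have t1 : Tendsto (fun v : ℝ => (1 + |v| ^ q) ^ (-s)) (cocompact ℝ) (𝓝 0) :=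
    tendsto_one_add_abs_rpow_neg hq0 (by linarith)
  have t2 : Tendsto (fun v : ℝ => |v| ^ q * (1 + |v| ^ q) ^ (-s)) (cocompact ℝ) (𝓝 0) := by
    refine squeeze_zero (fun v => by positivity) (fun v => ?_)
      (tendsto_one_add_abs_rpow_neg hq0 (γ := 1 - s) (by linarith))
    rw [sub_eq_add_neg, Real.rpow_add (hA v), Real.rpow_one]
    gcongr
    linarith
  have t3 : Tendsto (fun v : ℝ => v * (1 + |v| ^ q) ^ (-s)) (cocompact ℝ) (𝓝 0) := by
    refine squeeze_zero_norm (fun v => ?_)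
      (tendsto_one_add_abs_rpow_neg hq0 (γ := 1 / q - s) ?_)
    · rw [sub_eq_add_neg, Real.rpow_add (hA v), norm_mul, Real.norm_eq_abs, Real.norm_eq_abs,
        abs_of_pos (Real.rpow_pos_of_pos (hA v) (-s))]
      gcongr
      simpa using abs_rpow_le_one_add_abs_rpow hq0 zero_le_one v
    · have : 1 / q < 1 := by rw [div_lt_one hq0]; exact hq
      linarith
  have hz := integral_genTanExt_deriv_eq_zero hq hd t3
    (by rw [hG]; fun_prop) (by rw [hG]; simpa using t1.sub (t2.const_mul (s * q - 1)))
  rw [hG] at hz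
  have hsub : genTanExt q (fun v => (1 + |v| ^ q) ^ (-s) -
      (s * q - 1) * (|v| ^ q * (1 + |v| ^ q) ^ (-s))) =
      fun t => genTanExt q (fun v => (1 + |v| ^ q) ^ (-s)) t -
        (s * q - 1) * genTanExt q (fun v => |v| ^ q * (1 + |v| ^ q) ^ (-s)) t := by
    ext t
    by_cases ht : t ∈ Ioo (-genHalfPi q) (genHalfPi q)
    · simp only [genTanExt_of_mem _ ht]
    · simp only [genTanExt_of_notMem _ ht]; simp
  rw [hsub, integral_sub, integral_const_mul] at hz
  · linarith
  · exact (continuous_genTanExt hq hcA t1).integrable_of_hasCompactSupport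
      (hasCompactSupport_genTanExt _ _)
  · exact ((continuous_genTanExt hq (hcq.mul hcA) t2).integrable_of_hasCompactSupport
      (hasCompactSupport_genTanExt _ _)).const_mul _

/-- Continuously differentiable functions supported in `[-π_q/2, π_q/2]` with Rayleigh quotient
arbitrarily close to the optimal one. -/
theorem exists_rayleigh_lt {p q : ℝ} (hpq : p.HolderConjugate q) {μ : ℝ}
    (hμ : (p - 1) ^ (1 - p) < μ) :
    ∃ f g : ℝ → ℝ, (∀ t, HasDerivAt f (g t) t) ∧ Continuous g ∧
      (∀ t ∉ Icc (-genHalfPi q) (genHalfPi q), f t = 0) ∧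
      ∫ t, |g t| ^ p < μ * ∫ t, |f t| ^ p := by
  have hp : 1 < p := hpq.lt
  have hq : 1 < q := hpq.symm.lt
  have hp0 : 0 < p := by linarith
  have hq0 : 0 < q := by linarith
  have hA : ∀ v : ℝ, 0 < 1 + |v| ^ q := fun v => by positivity
  have hlim : Tendsto (fun s : ℝ => (s * q / p) ^ p / (s * q - 1)) (𝓝 1)
      (𝓝 ((1 * q / p) ^ p / (1 * q - 1))) := by
    have hc : ContinuousAt (fun s : ℝ => (s * q / p) ^ p / (s * q - 1)) 1 := by
      refine ContinuousAt.div ?_ (by fun_prop) (by linarith)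
      exact ContinuousAt.rpow_const (by fun_prop) (Or.inr hp0.le)
    exact hc
  have hval : (1 * q / p) ^ p / (1 * q - 1) = (p - 1) ^ (1 - p) := by
    have h1 : 0 < p - 1 := hpq.sub_one_pos
    have e1 : 1 * q / p = (p - 1)⁻¹ := by
      rw [hpq.conjugate_eq]; field_simp
    have e2 : 1 * q - 1 = (p - 1)⁻¹ := by
      rw [hpq.conjugate_eq]; field_simp; ring
    rw [e1, e2, Real.inv_rpow h1.le, Real.rpow_sub h1, Real.rpow_one]
    field_simp
  rw [hval] at hlim
  have hev : ∀ᶠ s in 𝓝[>] (1 : ℝ), (s * q / p) ^ p / (s * q - 1) < μ :=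
    (hlim.mono_left nhdsWithin_le_nhds).eventually (gt_mem_nhds hμ)
  obtain ⟨s, hsμ, hs⟩ := (hev.and self_mem_nhdsWithin).exists
  have hs : 1 < s := hs
  have hs0 : 0 < s := by linarith
  have hsq : 0 < s * q - 1 := by nlinarith
  have hG : (fun v : ℝ => -s / p * q * (|v| ^ (q - 2) * v) * (1 + |v| ^ q) ^ (-s / p - 1) *
      (1 + |v| ^ q)) =
      fun v => -s / p * q * (|v| ^ (q - 2) * v) * (1 + |v| ^ q) ^ (-s / p) := by
    ext v
    rw [mul_assoc, ← Real.rpow_add_one (hA v).ne']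
    congr 2
    ring
  have hcG : Continuous fun v : ℝ =>
      -s / p * q * (|v| ^ (q - 2) * v) * (1 + |v| ^ q) ^ (-s / p) :=
    ((continuous_abs_rpow_mul hq).const_mul _).mul (continuous_one_add_abs_rpow_rpow hq0 _)
  have hG0 : Tendsto (fun v : ℝ =>
      -s / p * q * (|v| ^ (q - 2) * v) * (1 + |v| ^ q) ^ (-s / p)) (cocompact ℝ) (𝓝 0) := by
    have hγ : (q - 1) / q + -s / p = (1 - s) / p := by
      have : q⁻¹ = 1 - p⁻¹ := hpq.one_sub_inv.symm
      have e : (q - 1) / q = 1 - q⁻¹ := by field_simp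
      rw [e, this]; ring
    have := (tendsto_one_add_abs_rpow_neg hq0 (γ := (1 - s) / p)
      (div_neg_of_neg_of_pos (by linarith) hp0)).const_mul (|(-s / p * q)|)
    rw [mul_zero] at this
    refine squeeze_zero_norm (fun v => ?_) this
    rw [Real.norm_eq_abs, abs_mul, abs_mul, abs_abs_rpow_mul hq, mul_assoc, ← hγ,
      Real.rpow_add (hA v), abs_of_pos (Real.rpow_pos_of_pos (hA v) (-s / p))]
    gcongr
    exact abs_rpow_le_one_add_abs_rpow hq0 (by linarith) v
  have hF0 : Tendsto (fun v : ℝ => (1 + |v| ^ q) ^ (-s / p)) (cocompact ℝ) (𝓝 0) :=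
    tendsto_one_add_abs_rpow_neg hq0 (div_neg_of_neg_of_pos (by linarith) hp0)
  have hder := hasDerivAt_genTanExt hq (hasDerivAt_one_add_abs_rpow_rpow hq (-s / p)) hF0
    (by rw [hG]; exact hcG) (by rw [hG]; exact hG0)
  rw [hG] at hder
  refine ⟨_, _, hder, continuous_genTanExt hq hcG hG0,
    fun t ht => genTanExt_of_notMem _ fun h => ht ⟨h.1.le, h.2.le⟩, ?_⟩
  have hf : ∀ t, |genTanExt q (fun v => (1 + |v| ^ q) ^ (-s / p)) t| ^ p =
      genTanExt q (fun v => (1 + |v| ^ q) ^ (-s)) t := by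
    intro t
    by_cases ht : t ∈ Ioo (-genHalfPi q) (genHalfPi q)
    · simp only [genTanExt_of_mem _ ht]
      rw [abs_of_pos (Real.rpow_pos_of_pos (hA _) _), ← Real.rpow_mul (hA _).le]
      congr 1
      field_simp
    · simp [genTanExt_of_notMem _ ht, Real.zero_rpow hp0.ne']
  have hg : ∀ t, |genTanExt q (fun v =>
      -s / p * q * (|v| ^ (q - 2) * v) * (1 + |v| ^ q) ^ (-s / p)) t| ^ p =
      (s * q / p) ^ p * genTanExt q (fun v => |v| ^ q * (1 + |v| ^ q) ^ (-s)) t := by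
    intro t
    by_cases ht : t ∈ Ioo (-genHalfPi q) (genHalfPi q)
    · simp only [genTanExt_of_mem _ ht]
      set v := genTan q t
      have e1 : |-s / p * q| = s * q / p := by
        rw [show -s / p * q = -(s * q / p) by ring, abs_neg, abs_of_pos (by positivity)]
      rw [abs_mul, abs_mul, abs_abs_rpow_mul hq, e1,
        abs_of_pos (Real.rpow_pos_of_pos (hA _) _),
        Real.mul_rpow (by positivity) (by positivity), Real.mul_rpow (by positivity) (by positivity),
        ← Real.rpow_mul (hA _).le, ← Real.rpow_mul (abs_nonneg v), hpq.symm.sub_one_mul_conj,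
        div_mul_cancel₀ _ hp0.ne', mul_assoc]
    · simp [genTanExt_of_notMem _ ht, Real.zero_rpow hp0.ne']
  simp_rw [hf, hg, integral_const_mul]
  have hen := integral_genTanExt_energy hq hs
  have hpos : 0 < ∫ t, genTanExt q (fun v => (1 + |v| ^ q) ^ (-s)) t := by
    refine Continuous.integral_pos_of_hasCompactSupport_nonneg_nonzero (x := 0)
      (continuous_genTanExt hq (continuous_one_add_abs_rpow_rpow hq0 _)
        (tendsto_one_add_abs_rpow_neg hq0 (by linarith)))
      (hasCompactSupport_genTanExt _ _) ?_ ?_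
    · exact fun t => indicator_nonneg (fun _ _ => by positivity) t
    · have := genHalfPi_pos hq
      rw [genTanExt_of_mem _ ⟨by linarith, this⟩]
      positivity
  rw [← hen] at hpos ⊢
  have hX := (mul_pos_iff_of_pos_left hsq).1 hpos
  rw [div_lt_iff₀ hsq] at hsμ
  nlinarith

theorem normed_convolution_eq_zero {h : ℝ → ℝ} {R ρ : ℝ} (hR : ∀ x ∉ Icc (-R) R, h x = 0)
    {φ : ContDiffBump (0 : ℝ)} (hφ : φ.rOut ≤ ρ) {x : ℝ} (hx : x ∉ Icc (-(R + ρ)) (R + ρ)) :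
    convolution (φ.normed volume) h (ContinuousLinearMap.lsmul ℝ ℝ) volume x = 0 := by
  have h0 : ∀ y ∈ Metric.ball x φ.rOut, h y = 0 := fun y hy => by
    refine hR y fun hy' => hx ?_
    rw [Metric.mem_ball, Real.dist_eq, abs_lt] at hy
    constructor <;> linarith [hy'.1, hy'.2]
  have hx0 : h x = 0 := h0 x (Metric.mem_ball_self φ.rOut_pos)
  rw [ContDiffBump.normed_convolution_eq_right fun y hy => by rw [h0 y hy, hx0], hx0]

theorem tendsto_integral_abs_normed_convolution_rpow {h : ℝ → ℝ} (hc : Continuous h) {R ρ : ℝ}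
    (hR : ∀ x ∉ Icc (-R) R, h x = 0) {p : ℝ} (hp : 0 < p) {φ : ℕ → ContDiffBump (0 : ℝ)}
    (hφ : Tendsto (fun n => (φ n).rOut) atTop (𝓝 0)) (hφρ : ∀ n, (φ n).rOut ≤ ρ) :
    Tendsto (fun n => ∫ x, |convolution ((φ n).normed volume) h (ContinuousLinearMap.lsmul ℝ ℝ)
      volume x| ^ p) atTop (𝓝 (∫ x, |h x| ^ p)) := by
  have hs : HasCompactSupport h := HasCompactSupport.intro isCompact_Icc hR
  obtain ⟨C, hC⟩ := hc.bounded_above_of_compact_support hs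
  refine tendsto_integral_of_dominated_convergence
    ((Icc (-(R + ρ)) (R + ρ)).indicator fun _ => (3 * C) ^ p) (fun n => ?_) ?_ (fun n => ?_) ?_
  · have := hs.continuous_convolution_right (ContinuousLinearMap.lsmul ℝ ℝ) (μ := volume)
      ((φ n).continuous_normed (μ := volume)).locallyIntegrable hc
    exact (this.abs.rpow_const fun _ => Or.inr hp.le).aestronglyMeasurable
  · exact (integrable_indicator_iff measurableSet_Icc).2
      (integrableOn_const (by simp) (by simp))
  · refine Eventually.of_forall fun x => ?_
    by_cases hx : x ∈ Icc (-(R + ρ)) (R + ρ)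
    · rw [indicator_of_mem hx, Real.norm_of_nonneg (by positivity)]
      refine Real.rpow_le_rpow (abs_nonneg _) ?_ hp.le
      have h1 := (φ n).dist_normed_convolution_le (μ := volume) (x₀ := x) (ε := 2 * C)
        hc.aestronglyMeasurable (fun y _ => by
          have := dist_le_norm_add_norm (h y) (h x)
          linarith [hC y, hC x])
      rw [Real.dist_eq] at h1
      have h2 := hC x
      rw [Real.norm_eq_abs] at h2
      have h3 := abs_add_le (convolution ((φ n).normed volume) h (ContinuousLinearMap.lsmul ℝ ℝ)
        volume x - h x) (h x)
      rw [sub_add_cancel] at h3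
      linarith
    · rw [indicator_of_notMem hx, normed_convolution_eq_zero hR (hφρ n) hx]
      simp [Real.zero_rpow hp.ne']
  · refine Eventually.of_forall fun x => ?_
    exact ((ContDiffBump.convolution_tendsto_right_of_continuous hφ hc x).abs).rpow_const
      (Or.inr hp.le)

/-- Smooth functions supported slightly outside `[-π_q/2, π_q/2]` almost realize the sharp
constant in the one-dimensional Poincaré inequality. -/
theorem exists_contDiff_rayleigh_lt {p q : ℝ} (hpq : p.HolderConjugate q) {μ : ℝ}
    (hμ : (p - 1) ^ (1 - p) < μ) {ρ : ℝ} (hρ : 0 < ρ) :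
    ∃ f : ℝ → ℝ, ContDiff ℝ (⊤ : ℕ∞) f ∧
      (∀ t ∉ Icc (-(genHalfPi q + ρ)) (genHalfPi q + ρ), f t = 0) ∧
      ∫ t, |deriv f t| ^ p < μ * ∫ t, |f t| ^ p := by
  obtain ⟨f, g, hfg, hg, hf0, hlt⟩ := exists_rayleigh_lt hpq hμ
  have hp := hpq.pos
  have hfd : deriv f = g := funext fun t => (hfg t).deriv
  have hf1 : ContDiff ℝ 1 f := contDiff_one_iff_deriv.2
    ⟨fun t => (hfg t).differentiableAt, by rwa [hfd]⟩
  have hfs : HasCompactSupport f := HasCompactSupport.intro isCompact_Icc hf0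
  have hg0 : ∀ t ∉ Icc (-genHalfPi q) (genHalfPi q), g t = 0 := fun t ht => by
    have : f =ᶠ[𝓝 t] fun _ => 0 := by
      filter_upwards [isClosed_Icc.isOpen_compl.mem_nhds ht] with y hy using hf0 y hy
    exact (hfg t).unique (this.hasDerivAt_iff.2 (hasDerivAt_const t 0))
  let φ : ℕ → ContDiffBump (0 : ℝ) := fun n =>
    ⟨ρ / (n + 1) / 2, ρ / (n + 1), by positivity, half_lt_self (by positivity)⟩
  have hφ : Tendsto (fun n => (φ n).rOut) atTop (𝓝 0) := by
    simpa [φ, div_eq_mul_inv] using (tendsto_one_div_add_atTop_nhds_zero_nat (𝕜 := ℝ)).const_mul ρ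
  have hφρ : ∀ n, (φ n).rOut ≤ ρ := fun n => div_le_self hρ.le (by simp)
  have hf := tendsto_integral_abs_normed_convolution_rpow hf1.continuous hf0 hp hφ hφρ
  have hg := tendsto_integral_abs_normed_convolution_rpow hg hg0 hp hφ hφρ
  obtain ⟨n, hn⟩ := (hg.eventually_lt (hf.const_mul μ) hlt).exists
  refine ⟨convolution ((φ n).normed volume) f (ContinuousLinearMap.lsmul ℝ ℝ) volume, ?_,
    fun t ht => normed_convolution_eq_zero hf0 (hφρ n) ht, ?_⟩
  · exact (φ n).hasCompactSupport_normed.contDiff_convolution_left _ (φ n).contDiff_normed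
      hf1.continuous.locallyIntegrable
  · have hd : deriv (convolution ((φ n).normed volume) f (ContinuousLinearMap.lsmul ℝ ℝ) volume) =
        convolution ((φ n).normed volume) g (ContinuousLinearMap.lsmul ℝ ℝ) volume := by
      rw [← hfd]
      exact funext fun t => (hfs.hasDerivAt_convolution_right _
        ((φ n).continuous_normed (μ := volume)).locallyIntegrable hf1 t).deriv
    rwa [hd]

/-- The sharp constant in the Poincaré inequality for `W₀^{1,p}` of an interval of length `ℓ`. -/
noncomputable def poincareConst (p ℓ : ℝ) : ℝ :=
  (p - 1) * (2 * Real.pi / (p * Real.sin (Real.pi / p))) ^ p * ℓ ^ (-p)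

theorem genHalfPi_eq {p q : ℝ} (hpq : p.HolderConjugate q) :
    genHalfPi q = (p - 1) * (Real.pi / (p * Real.sin (Real.pi / p))) := by
  have h1 : q = p / (p - 1) := hpq.conjugate_eq
  have h2 : Real.pi / q = Real.pi - Real.pi / p := by
    rw [h1]
    field_simp [hpq.ne_zero, hpq.sub_one_ne_zero]
  rw [genHalfPi, h2, Real.sin_pi_sub]
  have := (sin_pi_div_pos hpq.lt).ne'
  field_simp [hpq.ne_zero]

theorem poincareConst_eq {p q : ℝ} (hpq : p.HolderConjugate q) {ℓ : ℝ} (hℓ : 0 < ℓ) :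
    poincareConst p ℓ = (p - 1) ^ (1 - p) * (2 * genHalfPi q / ℓ) ^ p := by
  have hs := sin_pi_div_pos hpq.lt
  have hp := hpq.sub_one_pos
  have hp0 := hpq.pos
  have hpi := Real.pi_pos
  rw [poincareConst, genHalfPi_eq hpq,
    show 2 * ((p - 1) * (Real.pi / (p * Real.sin (Real.pi / p)))) / ℓ =
      (p - 1) * (2 * Real.pi / (p * Real.sin (Real.pi / p))) * ℓ⁻¹ by ring,
    Real.mul_rpow (by positivity) (by positivity), Real.mul_rpow (by positivity) (by positivity),
    Real.inv_rpow hℓ.le, ← Real.rpow_neg hℓ.le, ← mul_assoc, ← mul_assoc, ← Real.rpow_add hp]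
  simp

theorem poincareConst_nonneg {p : ℝ} (hp : 1 < p) {ℓ : ℝ} (hℓ : 0 ≤ ℓ) :
    0 ≤ poincareConst p ℓ := by
  have hs := sin_pi_div_pos hp
  have hpi := Real.pi_pos
  have : 0 < p - 1 := by linarith
  have : 0 < p := by linarith
  rw [poincareConst]; positivity

theorem exists_contDiff_rayleigh_lt_Ioo {p : ℝ} (hp : 1 < p) {a b : ℝ} (hab : a < b) {μ : ℝ}
    (hμ : poincareConst p (b - a) < μ) :
    ∃ f : ℝ → ℝ, ContDiff ℝ (⊤ : ℕ∞) f ∧ HasCompactSupport f ∧ tsupport f ⊆ Ioo a b ∧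
      ∫ t, |deriv f t| ^ p < μ * ∫ t, |f t| ^ p := by
  obtain ⟨q, hpq⟩ : ∃ q, p.HolderConjugate q := ⟨_, Real.HolderConjugate.conjExponent hp⟩
  have hH := genHalfPi_pos hpq.symm.lt
  set H := genHalfPi q with hHdef
  have hℓ : 0 < b - a := sub_pos.2 hab
  have hp1 : 0 < p - 1 := hpq.sub_one_pos
  rw [poincareConst_eq hpq hℓ] at hμ
  obtain ⟨ρ, hρ, hρμ⟩ : ∃ ρ > 0, (p - 1) ^ (1 - p) * (2 * (H + 2 * ρ) / (b - a)) ^ p < μ := by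
    have hcont : ContinuousAt
        (fun ρ : ℝ => (p - 1) ^ (1 - p) * (2 * (H + 2 * ρ) / (b - a)) ^ p) 0 := by
      refine continuousAt_const.mul (ContinuousAt.rpow_const (by fun_prop) (Or.inr hpq.pos.le))
    have := (hcont.eventually_lt (g := fun _ => μ) continuousAt_const (by simpa using hμ))
    obtain ⟨ε, hε, h⟩ := Metric.eventually_nhds_iff.1 this
    exact ⟨ε / 2, by positivity, h (by rw [Real.dist_eq, sub_zero, abs_of_pos] <;> linarith)⟩
  set c := 2 * (H + 2 * ρ) / (b - a) with hc
  have hc0 : 0 < c := by positivity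
  obtain ⟨f, hf, hf0, hlt⟩ := exists_contDiff_rayleigh_lt hpq (μ := μ / c ^ p)
    (by rwa [lt_div_iff₀ (by positivity)]) hρ
  set m := (a + b) / 2 with hm
  have hsupp : ∀ t ∉ Icc (m - (H + ρ) / c) (m + (H + ρ) / c), f (c * (t - m)) = 0 := by
    intro t ht
    refine hf0 _ fun h => ht ⟨?_, ?_⟩
    · have : -((H + ρ) / c) ≤ t - m := by
        rw [← neg_div, div_le_iff₀ hc0]; linarith [h.1]
      linarith
    · have : t - m ≤ (H + ρ) / c := by
        rw [le_div_iff₀ hc0]; linarith [h.2]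
      linarith
  have hlen : (H + ρ) / c < (b - a) / 2 := by
    rw [hc, div_div_eq_mul_div, div_lt_iff₀ (by positivity)]
    nlinarith
  refine ⟨fun t => f (c * (t - m)), hf.comp (by fun_prop), HasCompactSupport.intro isCompact_Icc
    hsupp, (closure_minimal (fun t ht => ?_) isClosed_Icc).trans
      (Icc_subset_Ioo (a₁ := m - (H + ρ) / c) (b₁ := m + (H + ρ) / c) (by linarith)
        (by linarith)), ?_⟩
  · by_contra h
    exact ht (hsupp t h)
  · have hd : ∀ t, deriv (fun t => f (c * (t - m))) t = c * deriv f (c * (t - m)) := fun t => by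
      have h1 : HasDerivAt f (deriv f (c * (t - m))) (c * (t - m)) :=
        (hf.differentiable (by simp) _).hasDerivAt
      have h2 : HasDerivAt (fun t => c * (t - m)) c t := by
        simpa using ((hasDerivAt_id t).sub_const m).const_mul c
      rw [mul_comm]
      exact (h1.comp t h2).deriv
    simp_rw [hd, abs_mul, Real.mul_rpow (abs_nonneg _) (abs_nonneg _), abs_of_pos hc0]
    rw [integral_const_mul, integral_sub_right_eq_self (fun t => |deriv f (c * t)| ^ p),
      integral_sub_right_eq_self (fun t => |f (c * t)| ^ p),
      Measure.integral_comp_mul_left (fun t => |deriv f t| ^ p),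
      Measure.integral_comp_mul_left (fun t => |f t| ^ p), smul_eq_mul, smul_eq_mul,
      mul_left_comm, mul_left_comm μ]
    refine mul_lt_mul_of_pos_left ?_ (by positivity)
    rwa [← lt_div_iff₀' (by positivity), mul_div_right_comm]

theorem exists_contDiff_rayleigh_lt_of_pos {p : ℝ} (hp : 1 < p) {μ : ℝ} (hμ : 0 < μ) :
    ∃ f : ℝ → ℝ, ContDiff ℝ (⊤ : ℕ∞) f ∧ HasCompactSupport f ∧
      ∫ t, |deriv f t| ^ p < μ * ∫ t, |f t| ^ p := by
  have h : Tendsto (fun ℓ => poincareConst p ℓ) atTop (𝓝 0) := by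
    simpa [poincareConst] using (tendsto_rpow_neg_atTop (zero_lt_one.trans hp)).const_mul
      ((p - 1) * (2 * Real.pi / (p * Real.sin (Real.pi / p))) ^ p)
  obtain ⟨ℓ, hℓ, hℓ0⟩ := ((h.eventually_lt_const hμ).and (eventually_gt_atTop 0)).exists
  obtain ⟨f, hf, hfs, -, hlt⟩ := exists_contDiff_rayleigh_lt_Ioo (a := 0) (b := ℓ) hp hℓ0
    (by rwa [sub_zero])
  exact ⟨f, hf, hfs, hlt⟩

theorem IsCompact.exists_subset_Ioo {K : Set ℝ} (hK : IsCompact K) {a b : ℝ} (hab : a < b)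
    (hKab : K ⊆ Ioo a b) : ∃ c d, a < c ∧ c ≤ d ∧ d < b ∧ K ⊆ Ioo c d := by
  rcases K.eq_empty_or_nonempty with rfl | hne
  · obtain ⟨c, hc, hc'⟩ := exists_between hab
    exact ⟨c, c, hc, le_rfl, hc', empty_subset _⟩
  · have h1 := hKab (hK.sInf_mem hne)
    have h2 := hKab (hK.sSup_mem hne)
    have h3 := csInf_le_csSup hne hK.bddBelow hK.bddAbove
    refine ⟨(a + sInf K) / 2, (sSup K + b) / 2, by linarith [h1.1], by linarith [h1.1, h2.2],
      by linarith [h2.2], fun x hx => ⟨?_, ?_⟩⟩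
    · linarith [h1.1, csInf_le hK.bddBelow hx]
    · linarith [h2.2, le_csSup hK.bddAbove hx]

/-- The sharp Poincaré inequality on an interval. -/
theorem poincareConst_mul_integral_le {p : ℝ} (hp : 1 < p) {a b : ℝ} (hab : a < b) {u u' : ℝ → ℝ}
    (hu : ∀ t, HasDerivAt u (u' t) t) (hu' : Continuous u') {K : Set ℝ} (hK : IsCompact K)
    (hKab : K ⊆ Ioo a b) (hu0 : ∀ t ∉ K, u t = 0) :
    poincareConst p (b - a) * ∫ t, |u t| ^ p ≤ ∫ t, |u' t| ^ p := by
  obtain ⟨c, d, hac, hcd, hdb, hKcd⟩ := hK.exists_subset_Ioo hab hKab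
  replace hu0 : ∀ t ∉ Ioo c d, u t = 0 := fun t ht => hu0 t fun h => ht (hKcd h)
  obtain ⟨q, hpq⟩ : ∃ q, p.HolderConjugate q := ⟨_, Real.HolderConjugate.conjExponent hp⟩
  have hH := genHalfPi_pos hpq.symm.lt
  have hℓ : 0 < b - a := sub_pos.2 hab
  have hp1 : 0 < p - 1 := hpq.sub_one_pos
  rw [poincareConst_eq hpq hℓ]
  set H := genHalfPi q with hHdef
  set r := 2 * H / (b - a) with hr
  have hr0 : 0 < r := by positivity
  set m := (a + b) / 2 with hm
  set κ := (r / (p - 1)) ^ (p - 1) with hκ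
  have hκ0 : 0 < κ := by positivity
  have hκr : κ * r = (p - 1) ^ (1 - p) * r ^ p := by
    rw [hκ, Real.div_rpow hr0.le hp1.le, ← neg_sub p 1, Real.rpow_neg hp1.le,
      Real.rpow_sub_one hr0.ne']
    field_simp
  have hκq : (p - 1) * κ ^ q = κ * r := by
    have h : κ ^ q = κ * (r / (p - 1)) := by
      have : (p - 1) * q = (p - 1) + 1 := by linarith [hpq.sub_one_mul_conj]
      rw [hκ, ← Real.rpow_mul (by positivity), this, Real.rpow_add_one (by positivity)]
    rw [h]; field_simp
  rw [← hκr]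
  have hucont : Continuous u := continuous_iff_continuousAt.2 fun t => (hu t).continuousAt
  have hu'0 : ∀ t ∉ Icc c d, u' t = 0 := fun t ht => by
    have : u =ᶠ[𝓝 t] fun _ => 0 := by
      filter_upwards [isClosed_Icc.isOpen_compl.mem_nhds ht] with y hy using
        hu0 y fun h => hy (Ioo_subset_Icc_self h)
    exact (hu t).unique (this.hasDerivAt_iff.2 (hasDerivAt_const t 0))
  have hc1 : Continuous fun t => |u t| ^ p := hucont.abs.rpow_const fun _ => Or.inr hpq.pos.le
  have hc2 : Continuous fun t => |u' t| ^ p := hu'.abs.rpow_const fun _ => Or.inr hpq.pos.le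
  have hmem : ∀ t ∈ Icc c d, (t - m) * r ∈ Ioo (-H) H := fun t ht => by
    have h1 : H = (b - a) / 2 * r := by rw [hr]; field_simp
    rw [h1]
    constructor <;> nlinarith [ht.1, ht.2]
  have hv : ∀ t ∈ Icc c d, HasDerivAt (fun t => genTan q ((t - m) * r))
      ((1 + |genTan q ((t - m) * r)| ^ q) * r) t := fun t ht =>
    (hasDerivAt_genTan hpq.symm.lt (hmem t ht)).comp t
      (by simpa using ((hasDerivAt_id t).sub_const m).mul_const r)
  have hw : ∀ t ∈ Icc c d, HasDerivAt (fun t => -κ * genTan q ((t - m) * r) * |u t| ^ p)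
      (-κ * ((1 + |genTan q ((t - m) * r)| ^ q) * r) * |u t| ^ p +
        -κ * genTan q ((t - m) * r) * (p * |u t| ^ (p - 2) * u t * u' t)) t := fun t ht =>
    ((hv t ht).const_mul (-κ)).mul ((hasDerivAt_abs_rpow (u t) hp).comp t (hu t))
  have key := intervalIntegral.sub_le_integral_of_hasDeriv_right_of_le hcd
    (φ := fun t => |u' t| ^ p - κ * r * |u t| ^ p)
    (fun t ht => (hw t ht).continuousAt.continuousWithinAt)
    (fun t ht => (hw t (Ioo_subset_Icc_self ht)).hasDerivWithinAt)
    ((hc2.sub (hc1.const_mul _)).integrableOn_Icc) (fun t _ => by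
      set v := genTan q ((t - m) * r)
      have h1 := Real.young_inequality_of_nonneg (abs_nonneg (u' t))
        (show 0 ≤ κ * |v| * |u t| ^ (p - 1) by positivity) hpq
      have h2 : (κ * |v| * |u t| ^ (p - 1)) ^ q = κ ^ q * |v| ^ q * |u t| ^ p := by
        rw [Real.mul_rpow (by positivity) (by positivity),
          Real.mul_rpow (by positivity) (by positivity), ← Real.rpow_mul (abs_nonneg _),
          hpq.sub_one_mul_conj]
      rw [h2] at h1
      have h3 : p * (κ ^ q * |v| ^ q * |u t| ^ p / q) = κ * r * |v| ^ q * |u t| ^ p := by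
        rw [← hκq, ← hpq.div_conj_eq_sub_one]
        ring
      have h4 : |-κ * v * (p * |u t| ^ (p - 2) * u t * u' t)| =
          p * (|u' t| * (κ * |v| * |u t| ^ (p - 1))) := by
        have : |u t| ^ (p - 2) * |u t| = |u t| ^ (p - 1) := by
          rcases eq_or_ne (u t) 0 with h0 | h0
          · simp [h0, Real.zero_rpow hp1.ne']
          · rw [← Real.rpow_add_one (abs_ne_zero.2 h0)]; congr 1; ring
        rw [← this]
        simp only [abs_mul, abs_neg, abs_of_pos hκ0, abs_of_pos hpq.pos,
          abs_of_nonneg (Real.rpow_nonneg (abs_nonneg (u t)) _)]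
        ring
      have h5 := (le_abs_self _).trans h4.le
      have h6 := mul_le_mul_of_nonneg_left h1 hpq.pos.le
      rw [mul_add, h3, mul_div_cancel₀ _ hpq.ne_zero] at h6
      have h7 : -κ * ((1 + |v| ^ q) * r) * |u t| ^ p =
        -(κ * r * |u t| ^ p) - κ * r * |v| ^ q * |u t| ^ p := by ring
      rw [h7]
      linarith)
  rw [hu0 c (by simp), hu0 d (by simp), abs_zero, Real.zero_rpow hpq.ne_zero, mul_zero, mul_zero,
    sub_zero, intervalIntegral.integral_sub (hc2.intervalIntegrable _ _)
      ((hc1.const_mul _).intervalIntegrable _ _), intervalIntegral.integral_const_mul,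
    sub_nonneg] at key
  have hz : (0 : ℝ) ^ p = 0 := Real.zero_rpow hpq.ne_zero
  rw [intervalIntegral.integral_of_le hcd, intervalIntegral.integral_of_le hcd,
    ← integral_Icc_eq_integral_Ioc, ← integral_Icc_eq_integral_Ioc,
    setIntegral_eq_integral_of_forall_compl_eq_zero (fun t ht => by
      rw [hu0 t fun h => ht (Ioo_subset_Icc_self h), abs_zero, hz]),
    setIntegral_eq_integral_of_forall_compl_eq_zero (fun t ht => by
      rw [hu'0 t ht, abs_zero, hz])] at key
  exact key

theorem integrable_comp_piFinSuccAbove_symm {m : ℕ} (i : Fin (m + 1)) {g : (Fin (m + 1) → ℝ) → ℝ}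
    (hg : Integrable g) : Integrable (fun z : ℝ × (Fin m → ℝ) => g (i.insertNth z.1 z.2)) :=
  ((volume_preserving_piFinSuccAbove (fun _ => ℝ) i).symm _).integrable_comp_emb
    (MeasurableEquiv.measurableEmbedding _) |>.2 hg

theorem integrable_integral_insertNth {m : ℕ} (i : Fin (m + 1)) {g : (Fin (m + 1) → ℝ) → ℝ}
    (hg : Integrable g) : Integrable (fun y : Fin m → ℝ => ∫ t : ℝ, g (i.insertNth t y)) :=
  (integrable_comp_piFinSuccAbove_symm i hg).integral_prod_right

theorem integral_eq_integral_insertNth {m : ℕ} (i : Fin (m + 1)) {g : (Fin (m + 1) → ℝ) → ℝ}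
    (hg : Integrable g) : ∫ x, g x = ∫ y : Fin m → ℝ, ∫ t : ℝ, g (i.insertNth t y) := by
  rw [← ((volume_preserving_piFinSuccAbove (fun _ => ℝ) i).symm _).integral_comp
    (MeasurableEquiv.measurableEmbedding _)]
  exact integral_prod_symm _ (integrable_comp_piFinSuccAbove_symm i hg)

theorem hasDerivAt_insertNth {m : ℕ} (i : Fin (m + 1)) (y : Fin m → ℝ) (t : ℝ) :
    HasDerivAt (fun t : ℝ => (i.insertNth t y : Fin (m + 1) → ℝ)) (Pi.single i 1) t := by
  refine hasDerivAt_pi.2 fun j => ?_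
  refine i.succAboveCases ?_ (fun l => ?_) j
  · simpa using hasDerivAt_id' t
  · simpa using hasDerivAt_const t (y l)

theorem integrable_abs_rpow_of_hasCompactSupport {X : Type*} [TopologicalSpace X] [MeasurableSpace X]
    [OpensMeasurableSpace X] {μ : Measure X} [IsFiniteMeasureOnCompacts μ] {g : X → ℝ}
    (hg : Continuous g) (hs : HasCompactSupport g) {p : ℝ} (hp : 0 < p) :
    Integrable (fun x => |g x| ^ p) μ :=
  (hg.abs.rpow_const fun _ => Or.inr hp.le).integrable_of_hasCompactSupport
    (hs.comp_left (g := fun y => |y| ^ p) (by simp [hp.ne']))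

namespace IsTestFun

variable {n : ℕ} {D : Set (Fin n → ℝ)} {u : (Fin n → ℝ) → ℝ}

theorem differentiable (hu : IsTestFun D u) : Differentiable ℝ u := hu.1.differentiable (by simp)

theorem continuous_pder (hu : IsTestFun D u) (i : Fin n) : Continuous (pder i u) :=
  (hu.1.continuous_fderiv (by simp)).clm_apply continuous_const

theorem pder_eq_zero {i : Fin n} {x : Fin n → ℝ} (hx : x ∉ tsupport u) : pder i u x = 0 := by
  rw [pder, image_eq_zero_of_notMem_tsupport fun h => hx (tsupport_fderiv_subset ℝ h)]
  rfl

theorem hasCompactSupport_pder (hu : IsTestFun D u) (i : Fin n) : HasCompactSupport (pder i u) :=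
  HasCompactSupport.intro hu.2.1 fun _ => pder_eq_zero

theorem poincareConst_mul_integral_le {n k : ℕ} {a b : Fin n → ℝ} {u : (Fin n → ℝ) → ℝ}
    (hu : IsTestFun (stripDomain n k a b) u) {i : Fin n} (hi : k ≤ (i : ℕ)) (hab : a i < b i)
    {p : ℝ} (hp : 1 < p) :
    poincareConst p (b i - a i) * ∫ x, |u x| ^ p ≤ ∫ x, |pder i u x| ^ p := by
  obtain ⟨m, rfl⟩ : ∃ m, n = m + 1 := ⟨n - 1, by have := i.pos; omega⟩
  have hp0 : 0 < p := zero_lt_one.trans hp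
  have h1 := integrable_abs_rpow_of_hasCompactSupport (μ := volume) hu.1.continuous hu.2.1 hp0
  have h2 := integrable_abs_rpow_of_hasCompactSupport (μ := volume) (hu.continuous_pder i) (hu.hasCompactSupport_pder i)
    hp0
  rw [integral_eq_integral_insertNth i h1, integral_eq_integral_insertNth i h2,
    ← integral_const_mul]
  refine integral_mono ((integrable_integral_insertNth i h1).const_mul _)
    (integrable_integral_insertNth i h2) fun y => ?_
  have hc : Continuous fun t : ℝ => (i.insertNth t y : Fin (m + 1) → ℝ) :=
    continuous_iff_continuousAt.2 fun t => (hasDerivAt_insertNth i y t).continuousAt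
  refine _root_.poincareConst_mul_integral_le hp hab (K := (fun x : Fin (m + 1) → ℝ => x i) ''
    tsupport u) (fun t => ((hu.differentiable _).hasFDerivAt.comp_hasDerivAt t
      (hasDerivAt_insertNth i y t))) ((hu.continuous_pder i).comp hc)
    (hu.2.1.image (continuous_apply i)) ?_ ?_
  · rintro _ ⟨x, hx, rfl⟩
    exact hu.2.2 hx i hi
  · intro t ht
    exact image_eq_zero_of_notMem_tsupport fun h => ht ⟨_, h, by simp⟩

end IsTestFun

namespace IsTestFun

variable {n : ℕ} {D : Set (Fin n → ℝ)} {u v : (Fin n → ℝ) → ℝ}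

theorem zero : IsTestFun D (0 : (Fin n → ℝ) → ℝ) :=
  ⟨contDiff_const, HasCompactSupport.zero, by simp [tsupport]⟩

theorem add (hu : IsTestFun D u) (hv : IsTestFun D v) : IsTestFun D (u + v) :=
  ⟨hu.1.add hv.1, hu.2.1.add hv.2.1, (tsupport_add u v).trans (union_subset hu.2.2 hv.2.2)⟩

theorem const_smul (hu : IsTestFun D u) (c : ℝ) : IsTestFun D (c • u) :=
  ⟨hu.1.const_smul c, hu.2.1.smul_left, (tsupport_smul_subset_right (fun _ => c) u).trans hu.2.2⟩

theorem jet_zero {p : ℝ≥0∞} (x : Fin n → ℝ) : jet p (0 : (Fin n → ℝ) → ℝ) x = 0 := by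
  ext i
  refine Fin.cases ?_ (fun j => ?_) i <;> simp [jet, pder]

theorem jet_add (hu : IsTestFun D u) (hv : IsTestFun D v) {p : ℝ≥0∞} (x : Fin n → ℝ) :
    jet p (u + v) x = jet p u x + jet p v x := by
  ext i
  refine Fin.cases ?_ (fun j => ?_) i
  · simp [jet]
  · simp [jet, pder, fderiv_add (hu.differentiable x) (hv.differentiable x)]

theorem jet_const_smul (hu : IsTestFun D u) (c : ℝ) {p : ℝ≥0∞} (x : Fin n → ℝ) :
    jet p (c • u) x = c • jet p u x := by
  ext i
  refine Fin.cases ?_ (fun j => ?_) i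
  · simp [jet]
  · simp [jet, pder, fderiv_const_smul (hu.differentiable x) c]

theorem continuous_jet (hu : IsTestFun D u) (p : ℝ≥0∞) : Continuous (jet p u) := by
  refine (PiLp.continuous_toLp p _).comp (continuous_pi fun i => ?_)
  refine Fin.cases ?_ (fun j => ?_) i
  · simpa using hu.1.continuous
  · simpa using hu.continuous_pder j

theorem hasCompactSupport_jet (hu : IsTestFun D u) (p : ℝ≥0∞) : HasCompactSupport (jet p u) := by
  refine HasCompactSupport.intro hu.2.1 fun x hx => ?_
  ext i
  refine Fin.cases ?_ (fun j => ?_) i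
  · simpa [jet] using image_eq_zero_of_notMem_tsupport hx
  · simpa [jet] using pder_eq_zero hx

variable {p : ℝ≥0∞} [Fact (1 ≤ p)]

theorem memLp_jet (hu : IsTestFun D u) : MemLp (jet p u) p volume :=
  (hu.continuous_jet p).memLp_of_hasCompactSupport (hu.hasCompactSupport_jet p)

/-- The element of `W₀^{1,p}(D)` given by a test function. -/
noncomputable def toW0sub (p : ℝ≥0∞) [Fact (1 ≤ p)] (hu : IsTestFun D u) : W0sub p D :=
  ⟨hu.memLp_jet.toLp, Submodule.le_topologicalClosure _
    (Submodule.subset_span ⟨u, hu, hu.memLp_jet.coeFn_toLp⟩)⟩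

theorem norm_toW0sub_rpow (hp : p ≠ ⊤) (hu : IsTestFun D u) :
    ‖hu.toW0sub p‖ ^ p.toReal =
      (∫ x, |u x| ^ p.toReal) + ∑ i, ∫ x, |pder i u x| ^ p.toReal := by
  have hp1 : 1 ≤ p := Fact.out
  have hp0 : 0 < p.toReal := ENNReal.toReal_pos (zero_lt_one.trans_le hp1).ne' hp
  have hint : ∀ i, Integrable (fun x => |pder i u x| ^ p.toReal) volume := fun i =>
    integrable_abs_rpow_of_hasCompactSupport (hu.continuous_pder i) (hu.hasCompactSupport_pder i) hp0
  have hnorm : ∀ x, ‖jet p u x‖ ^ p.toReal =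
      |u x| ^ p.toReal + ∑ i, |pder i u x| ^ p.toReal := fun x => by
    rw [PiLp.norm_eq_sum hp0, ← Real.rpow_mul (by positivity), one_div_mul_cancel hp0.ne',
      Real.rpow_one, Fin.sum_univ_succ]
    simp [jet]
  rw [toW0sub, Submodule.coe_norm, Lp.norm_toLp,
    hu.memLp_jet.eLpNorm_eq_integral_rpow_norm (zero_lt_one.trans_le hp1).ne' hp,
    ENNReal.toReal_ofReal (by positivity), ← Real.rpow_mul (by positivity),
    inv_mul_cancel₀ hp0.ne', Real.rpow_one, ← integral_finsetSum _ fun i _ => hint i,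
    ← integral_add (integrable_abs_rpow_of_hasCompactSupport hu.1.continuous hu.2.1 hp0)
      (integrable_finsetSum _ fun i _ => hint i)]
  exact integral_congr_ae (Eventually.of_forall hnorm)

theorem coeFn_sobolevEmb_toW0sub (hu : IsTestFun D u) :
    SobolevEmb p D (hu.toW0sub p) =ᵐ[volume] u := by
  refine ((proj0 n p).coeFn_compLpL (hu.toW0sub p : Vsp n p)).trans ?_
  filter_upwards [(hu.memLp_jet (p := p)).coeFn_toLp] with x hx
  rw [toW0sub, hx]
  simp [proj0, jet]

theorem norm_sobolevEmb_toW0sub_rpow (hp : p ≠ ⊤) (hu : IsTestFun D u) :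
    ‖SobolevEmb p D (hu.toW0sub p)‖ ^ p.toReal = ∫ x, |u x| ^ p.toReal := by
  have hp1 : 1 ≤ p := Fact.out
  have hp0 : 0 < p.toReal := ENNReal.toReal_pos (zero_lt_one.trans_le hp1).ne' hp
  have hm : MemLp u p volume := hu.1.continuous.memLp_of_hasCompactSupport hu.2.1
  rw [Lp.norm_def, eLpNorm_congr_ae hu.coeFn_sobolevEmb_toW0sub,
    hm.eLpNorm_eq_integral_rpow_norm (zero_lt_one.trans_le hp1).ne' hp,
    ENNReal.toReal_ofReal (by positivity), ← Real.rpow_mul (by positivity),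
    inv_mul_cancel₀ hp0.ne', Real.rpow_one]
  rfl

end IsTestFun

theorem exists_isTestFun_of_mem_span {n : ℕ} {D : Set (Fin n → ℝ)} {p : ℝ≥0∞} [Fact (1 ≤ p)]
    {f : Vsp n p} (hf : f ∈ Submodule.span ℝ {f : Vsp n p | ∃ u : (Fin n → ℝ) → ℝ,
      IsTestFun D u ∧ f =ᵐ[volume] jet p u}) :
    ∃ u, IsTestFun D u ∧ f =ᵐ[volume] jet p u := by
  induction hf using Submodule.span_induction with
  | mem f hf => exact hf
  | zero =>
    refine ⟨0, IsTestFun.zero, ?_⟩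
    filter_upwards [Lp.coeFn_zero (PiLp p fun _ : Fin (n + 1) => ℝ) p
      (volume : Measure (Fin n → ℝ))] with x hx
    rw [hx, IsTestFun.jet_zero, Pi.zero_apply]
  | add f g _ _ hf hg =>
    obtain ⟨u, hu, hfu⟩ := hf
    obtain ⟨v, hv, hgv⟩ := hg
    refine ⟨u + v, hu.add hv, ?_⟩
    filter_upwards [Lp.coeFn_add f g, hfu, hgv] with x hx h1 h2
    rw [hx, Pi.add_apply, h1, h2, hu.jet_add hv]
  | smul c f _ hf =>
    obtain ⟨u, hu, hfu⟩ := hf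
    refine ⟨c • u, hu.const_smul c, ?_⟩
    filter_upwards [Lp.coeFn_smul c f, hfu] with x hx h1
    rw [hx, Pi.smul_apply, h1, hu.jet_const_smul c]

/-- Test functions are dense in `W₀^{1,p}(D)`. -/
theorem W0sub.closure_testFun {n : ℕ} {D : Set (Fin n → ℝ)} {p : ℝ≥0∞} [Fact (1 ≤ p)]
    {P : W0sub (n := n) p D → Prop} (hP : IsClosed {x | P x})
    (h : ∀ u (hu : IsTestFun D u), P (hu.toW0sub p)) (x : W0sub p D) : P x := by
  have hx : (x : Vsp n p) ∈ closure (Subtype.val '' {x : W0sub p D | P x}) := by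
    refine closure_mono (fun f hf => ?_) x.2
    obtain ⟨u, hu, hfu⟩ := exists_isTestFun_of_mem_span hf
    refine ⟨hu.toW0sub p, h u hu, ?_⟩
    exact Lp.ext (hu.memLp_jet.coeFn_toLp.trans hfu.symm)
  have h2 : x ∈ closure {x : W0sub p D | P x} := by
    rwa [Topology.IsEmbedding.subtypeVal.closure_eq_preimage_closure_image]
  rwa [hP.closure_eq] at h2

theorem norm_sobolevEmb_le_of_testFun {n : ℕ} {D : Set (Fin n → ℝ)} {p : ℝ≥0∞} [Fact (1 ≤ p)]
    {C : ℝ} (hC : 0 ≤ C)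
    (h : ∀ u (hu : IsTestFun D u), ‖SobolevEmb p D (hu.toW0sub p)‖ ≤ C * ‖hu.toW0sub p‖) :
    ‖SobolevEmb p D‖ ≤ C :=
  ContinuousLinearMap.opNorm_le_bound _ hC <| W0sub.closure_testFun
    (isClosed_le (by fun_prop) (by fun_prop)) h

theorem entropyNumber_eq_norm {X Y : Type*} [NormedAddCommGroup X] [NormedSpace ℝ X]
    [NormedAddCommGroup Y] [NormedSpace ℝ Y] {T : X →L[ℝ] Y} (hT : 0 < ‖T‖)
    (h : ∀ {N : ℕ} (c : Fin N → Y) {ε : ℝ}, (∀ x : X, ‖x‖ ≤ 1 → ∃ j, ‖T x - c j‖ ≤ ε) → ‖T‖ ≤ ε)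
    (m : ℕ) : entropyNumber m T = ‖T‖ := by
  have hmem : ‖T‖ ∈ {ε : ℝ | 0 < ε ∧ ∃ c : Fin (2 ^ (m - 1)) → Y,
      ∀ x : X, ‖x‖ ≤ 1 → ∃ j, ‖T x - c j‖ ≤ ε} :=
    ⟨hT, 0, fun x hx => ⟨⟨0, by positivity⟩, by simpa using T.le_of_opNorm_le_of_le le_rfl hx⟩⟩
  refine le_antisymm (csInf_le ⟨0, fun ε hε => hε.1.le⟩ hmem) (le_csInf ⟨_, hmem⟩ ?_)
  rintro ε ⟨-, c, hc⟩
  exact h c hc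

theorem Lp.exists_hasCompactSupport_norm_sub_le {n : ℕ} {p : ℝ≥0∞} [Fact (1 ≤ p)] (hp : p ≠ ⊤)
    (f : Lp ℝ p (volume : Measure (Fin n → ℝ))) {δ : ℝ} (hδ : 0 < δ) :
    ∃ g : Lp ℝ p (volume : Measure (Fin n → ℝ)), ‖f - g‖ ≤ δ ∧
      ∃ K : Set (Fin n → ℝ), IsCompact K ∧ ∀ᵐ x, x ∉ K → g x = 0 := by
  obtain ⟨g, hg, hfg, -, hgm⟩ := (Lp.memLp f).exists_hasCompactSupport_eLpNorm_sub_le hp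
    (ε := ENNReal.ofReal δ) (by simpa using hδ)
  refine ⟨hgm.toLp, ?_, tsupport g, hg, ?_⟩
  · rw [Lp.norm_def]
    refine ENNReal.toReal_le_of_le_ofReal hδ.le (le_of_eq_of_le (eLpNorm_congr_ae ?_) hfg)
    filter_upwards [Lp.coeFn_sub f hgm.toLp, hgm.coeFn_toLp] with x h1 h2
    rw [h1, Pi.sub_apply, h2, Pi.sub_apply]
  · filter_upwards [hgm.coeFn_toLp] with x hx h
    rw [hx, image_eq_zero_of_notMem_tsupport h]

theorem tsupport_comp_sub {n : ℕ} (u : (Fin n → ℝ) → ℝ) (c : Fin n → ℝ) :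
    tsupport (fun x => u (x - c)) = (Homeomorph.subRight c) ⁻¹' tsupport u :=
  tsupport_comp_eq_preimage u (Homeomorph.subRight c)

theorem pder_comp_sub {n : ℕ} (u : (Fin n → ℝ) → ℝ) (c : Fin n → ℝ) (i : Fin n) (x : Fin n → ℝ) :
    pder i (fun x => u (x - c)) x = pder i u (x - c) := by
  rw [pder, fderiv_comp_sub, pder]

theorem norm_sobolevEmb_le_of_cover {n k : ℕ} {a b : Fin n → ℝ} {p : ℝ≥0∞} [Fact (1 ≤ p)]
    (hp : p ≠ ⊤) {i₀ : Fin n} (hi₀ : (i₀ : ℕ) < k) {N : ℕ}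
    (c : Fin N → Lp ℝ p (volume : Measure (Fin n → ℝ))) {ε : ℝ}
    (hc : ∀ x : W0sub p (stripDomain n k a b), ‖x‖ ≤ 1 →
      ∃ j, ‖SobolevEmb p (stripDomain n k a b) x - c j‖ ≤ ε) :
    ‖SobolevEmb p (stripDomain n k a b)‖ ≤ ε := by
  have hp1 : 1 ≤ p := Fact.out
  have hp0 : 0 < p.toReal := ENNReal.toReal_pos (zero_lt_one.trans_le hp1).ne' hp
  have hε : 0 ≤ ε := by
    obtain ⟨j, hj⟩ := hc 0 (by simp)
    exact (norm_nonneg _).trans hj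
  refine norm_sobolevEmb_le_of_testFun hε fun u hu => le_of_forall_pos_le_add fun δ hδ => ?_
  set s := ‖hu.toW0sub p‖ with hs
  rcases (norm_nonneg (hu.toW0sub p)).eq_or_lt with hs0 | hs0
  · rw [norm_eq_zero.1 hs0.symm, map_zero, norm_zero]
    positivity
  rw [← hs] at hs0
  choose y hy K hK hyK using fun j => Lp.exists_hasCompactSupport_norm_sub_le hp (c j)
    (δ := δ / s) (by positivity)
  obtain ⟨R, hR⟩ := ((isCompact_iUnion hK).image (continuous_apply i₀)).isBounded.exists_norm_le
  obtain ⟨R', hR'⟩ := (hu.2.1.isCompact.image (continuous_apply i₀)).isBounded.exists_norm_le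
  set τ : Fin n → ℝ := Pi.single i₀ (|R| + |R'| + 1) with hτ
  have hv : IsTestFun (stripDomain n k a b) fun x => u (x - τ) := by
    refine ⟨hu.1.comp (by fun_prop), hu.2.1.comp_homeomorph (Homeomorph.subRight τ), ?_⟩
    rw [tsupport_comp_sub]
    intro x hx i hi
    have : i ≠ i₀ := by rintro rfl; omega
    simpa [hτ, this] using hu.2.2 hx i hi
  have hvs : ‖hv.toW0sub p‖ = s := by
    rw [← Real.rpow_left_inj (norm_nonneg _) (norm_nonneg _) hp0.ne', hv.norm_toW0sub_rpow hp,
      hu.norm_toW0sub_rpow hp]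
    simp_rw [pder_comp_sub]
    rw [integral_sub_right_eq_self (fun x => |u x| ^ p.toReal)]
    congr 1
    exact Finset.sum_congr rfl fun i _ =>
      integral_sub_right_eq_self (fun x => |pder i u x| ^ p.toReal) τ
  have hvu : ‖SobolevEmb p (stripDomain n k a b) (hv.toW0sub p)‖ =
      ‖SobolevEmb p (stripDomain n k a b) (hu.toW0sub p)‖ := by
    rw [← Real.rpow_left_inj (norm_nonneg _) (norm_nonneg _) hp0.ne',
      hv.norm_sobolevEmb_toW0sub_rpow hp, hu.norm_sobolevEmb_toW0sub_rpow hp,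
      integral_sub_right_eq_self (fun x => |u x| ^ p.toReal)]
  obtain ⟨j, hj⟩ := hc (s⁻¹ • hv.toW0sub p) (by
    rw [norm_smul, hvs, norm_inv, Real.norm_of_nonneg hs0.le, inv_mul_cancel₀ hs0.ne'])
  have hle : ‖SobolevEmb p (stripDomain n k a b) (s⁻¹ • hv.toW0sub p)‖ ≤
      ‖SobolevEmb p (stripDomain n k a b) (s⁻¹ • hv.toW0sub p) - y j‖ := by
    refine Lp.norm_le_norm_of_ae_le ?_
    rw [map_smul]
    filter_upwards [Lp.coeFn_sub (s⁻¹ • SobolevEmb p (stripDomain n k a b) (hv.toW0sub p)) (y j),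
      Lp.coeFn_smul s⁻¹ (SobolevEmb p (stripDomain n k a b) (hv.toW0sub p)),
      hv.coeFn_sobolevEmb_toW0sub (p := p), hyK j] with x h1 h2 h3 h4
    rw [h1, Pi.sub_apply, h2, Pi.smul_apply, h3]
    by_cases hx : x ∈ K j
    · have h5 : u (x - τ) = 0 := by
        refine image_eq_zero_of_notMem_tsupport fun h => ?_
        have h6 := hR _ ⟨x, mem_iUnion.2 ⟨j, hx⟩, rfl⟩
        have h7 := hR' _ ⟨_, h, rfl⟩
        simp only [hτ, Pi.sub_apply, Pi.single_eq_same, Real.norm_eq_abs, abs_le] at h6 h7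
        linarith [le_abs_self R, le_abs_self R', h6.2, h7.1]
      simp [h5]
    · simp [h4 hx]
  have h1 : ‖SobolevEmb p (stripDomain n k a b) (s⁻¹ • hv.toW0sub p)‖ ≤ ε + δ / s := by
    refine hle.trans ?_
    rw [← sub_add_sub_cancel _ (c j) (y j)]
    exact (norm_add_le _ _).trans (add_le_add hj (hy j))
  rw [map_smul, norm_smul, hvu, norm_inv, Real.norm_of_nonneg hs0.le,
    inv_mul_le_iff₀ hs0] at h1
  calc _ ≤ _ := h1
    _ = ε * s + δ := by field_simp

section ProductFunctions

variable {n : ℕ} {ψ : Fin n → ℝ → ℝ}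

theorem isTestFun_prod {k : ℕ} {a b : Fin n → ℝ} (hψ : ∀ i, ContDiff ℝ (⊤ : ℕ∞) (ψ i))
    (hs : ∀ i, HasCompactSupport (ψ i))
    (hab : ∀ i : Fin n, k ≤ (i : ℕ) → tsupport (ψ i) ⊆ Ioo (a i) (b i)) :
    IsTestFun (stripDomain n k a b) fun x => ∏ i, ψ i (x i) := by
  have hK : IsCompact (Set.univ.pi fun i => tsupport (ψ i)) := isCompact_univ_pi hs
  have h0 : ∀ x ∉ Set.univ.pi fun i => tsupport (ψ i), ∏ i, ψ i (x i) = 0 := fun x hx => by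
    simp only [Set.mem_univ_pi, not_forall] at hx
    obtain ⟨i, hi⟩ := hx
    exact Finset.prod_eq_zero (Finset.mem_univ i) (image_eq_zero_of_notMem_tsupport hi)
  refine ⟨contDiff_prod fun i _ => (hψ i).comp (contDiff_apply ℝ ℝ i), HasCompactSupport.intro hK h0,
    (closure_minimal (fun x hx => ?_) hK.isClosed).trans fun x hx i hi =>
      hab i hi (hx i (mem_univ i))⟩
  by_contra h
  exact hx (h0 x h)

theorem pder_prod (hψ : ∀ i, Differentiable ℝ (ψ i)) (i : Fin n) (x : Fin n → ℝ) :
    pder i (fun x => ∏ j, ψ j (x j)) x =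
      ∏ j, Function.update ψ i (deriv (ψ i)) j (x j) := by
  have hd : Differentiable ℝ fun x : Fin n → ℝ => ∏ j, ψ j (x j) := by fun_prop
  have h1 : HasDerivAt (fun t => ∏ j, ψ j (Function.update x i t j))
      (pder i (fun x => ∏ j, ψ j (x j)) x) (x i) := by
    have := (hd (Function.update x i (x i))).hasFDerivAt.comp_hasDerivAt (x i)
      (hasDerivAt_update x i (x i))
    rwa [Function.update_eq_self] at this
  have h2 : (fun t => ∏ j, ψ j (Function.update x i t j)) =
      fun t => ψ i t * ∏ j ∈ Finset.univ.erase i, ψ j (x j) := funext fun t => by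
    rw [← Finset.mul_prod_erase _ _ (Finset.mem_univ i), Function.update_self]
    congr 1
    refine Finset.prod_congr rfl fun j hj => ?_
    rw [Function.update_of_ne (Finset.ne_of_mem_erase hj)]
  rw [h2] at h1
  rw [h1.unique ((hψ i (x i)).hasDerivAt.mul_const _),
    ← Finset.mul_prod_erase _ _ (Finset.mem_univ i), Function.update_self]
  congr 1
  refine Finset.prod_congr rfl fun j hj => ?_
  rw [Function.update_of_ne (Finset.ne_of_mem_erase hj)]

theorem integral_abs_prod_rpow (p : ℝ) :
    ∫ x : Fin n → ℝ, |∏ i, ψ i (x i)| ^ p = ∏ i, ∫ t, |ψ i t| ^ p := by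
  simp_rw [Finset.abs_prod, ← Real.finsetProd_rpow _ _ fun i _ => abs_nonneg _]
  exact integral_fintype_prod_volume_eq_prod fun i t => |ψ i t| ^ p

end ProductFunctions

/-- The sharp constant in the Poincaré inequality for the `i`-th partial derivative on the strip. -/
noncomputable def stripConst {n : ℕ} (k : ℕ) (a b : Fin n → ℝ) (p : ℝ) (i : Fin n) : ℝ :=
  if k ≤ (i : ℕ) then poincareConst p (b i - a i) else 0

section StripConst

variable {n k : ℕ} {a b : Fin n → ℝ} {p : ℝ}

theorem stripConst_nonneg (hab : ∀ i : Fin n, k ≤ (i : ℕ) → a i < b i) (hp : 1 < p) (i : Fin n) :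
    0 ≤ stripConst k a b p i := by
  unfold stripConst
  split_ifs with hi
  · exact poincareConst_nonneg hp (sub_nonneg.2 (hab i hi).le)
  · exact le_rfl

theorem stripConst_mul_integral_le (hab : ∀ i : Fin n, k ≤ (i : ℕ) → a i < b i) (hp : 1 < p)
    {u : (Fin n → ℝ) → ℝ} (hu : IsTestFun (stripDomain n k a b) u) (i : Fin n) :
    stripConst k a b p i * ∫ x, |u x| ^ p ≤ ∫ x, |pder i u x| ^ p := by
  unfold stripConst
  split_ifs with hi
  · exact hu.poincareConst_mul_integral_le hi (hab i hi) hp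
  · rw [zero_mul]
    positivity

theorem exists_isTestFun_integral_pder_le (hab : ∀ i : Fin n, k ≤ (i : ℕ) → a i < b i)
    (hp : 1 < p) {δ : ℝ} (hδ : 0 < δ) :
    ∃ u, IsTestFun (stripDomain n k a b) u ∧ 0 < ∫ x, |u x| ^ p ∧
      ∀ i, ∫ x, |pder i u x| ^ p ≤ (stripConst k a b p i + δ) * ∫ x, |u x| ^ p := by
  have h : ∀ i : Fin n, ∃ f : ℝ → ℝ, ContDiff ℝ (⊤ : ℕ∞) f ∧ HasCompactSupport f ∧
      (k ≤ (i : ℕ) → tsupport f ⊆ Ioo (a i) (b i)) ∧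
      ∫ t, |deriv f t| ^ p < (stripConst k a b p i + δ) * ∫ t, |f t| ^ p := fun i => by
    unfold stripConst
    split_ifs with hi
    · obtain ⟨f, h1, h2, h3, h4⟩ := exists_contDiff_rayleigh_lt_Ioo hp (hab i hi)
        (lt_add_of_pos_right _ hδ)
      exact ⟨f, h1, h2, fun _ => h3, h4⟩
    · obtain ⟨f, h1, h2, h3⟩ := exists_contDiff_rayleigh_lt_of_pos hp
        (lt_add_of_pos_right 0 hδ)
      exact ⟨f, h1, h2, fun h => absurd h hi, h3⟩
  choose ψ h1 h2 h3 h4 using h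
  have hA : ∀ i, 0 < ∫ t, |ψ i t| ^ p := fun i => by
    have hB : 0 ≤ ∫ t, |deriv (ψ i) t| ^ p := by positivity
    have := stripConst_nonneg hab hp i
    exact pos_of_mul_pos_right (hB.trans_lt (h4 i)) (by positivity)
  refine ⟨_, isTestFun_prod h1 h2 h3, ?_, fun i => ?_⟩
  · rw [integral_abs_prod_rpow]
    exact Finset.prod_pos fun i _ => hA i
  · simp_rw [pder_prod fun i => (h1 i).differentiable (by simp), integral_abs_prod_rpow]
    rw [← Finset.mul_prod_erase _ _ (Finset.mem_univ i),
      ← Finset.mul_prod_erase _ (fun i => ∫ t, |ψ i t| ^ p) (Finset.mem_univ i), ← mul_assoc,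
      Function.update_self]
    refine mul_le_mul (h4 i).le (le_of_eq (Finset.prod_congr rfl fun j hj => ?_))
      (Finset.prod_nonneg fun j _ => by positivity) ?_
    · rw [Function.update_of_ne (Finset.ne_of_mem_erase hj)]
    · exact (integral_nonneg fun t => by positivity).trans (h4 i).le

end StripConst

theorem norm_sobolevEmb_stripDomain {n k : ℕ} {a b : Fin n → ℝ}
    (hab : ∀ i : Fin n, k ≤ (i : ℕ) → a i < b i) {p : ℝ≥0∞} [Fact (1 ≤ p)] (hp : 1 < p.toReal)
    (hpt : p ≠ ⊤) :
    ‖SobolevEmb p (stripDomain n k a b)‖ =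
      (1 + ∑ i, stripConst k a b p.toReal i) ^ (-1 / p.toReal) := by
  have hp0 : 0 < p.toReal := zero_lt_one.trans hp
  have hΛ : 0 ≤ ∑ i, stripConst k a b p.toReal i :=
    Finset.sum_nonneg fun i _ => stripConst_nonneg hab hp i
  set Λ := ∑ i, stripConst k a b p.toReal i with hΛdef
  have hpow : ((1 + Λ) ^ (-1 / p.toReal)) ^ p.toReal = (1 + Λ)⁻¹ := by
    rw [← Real.rpow_mul (by positivity), div_mul_cancel₀ _ hp0.ne', Real.rpow_neg_one]
  refine le_antisymm (norm_sobolevEmb_le_of_testFun (by positivity) fun u hu => ?_) ?_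
  · rw [← Real.rpow_le_rpow_iff (norm_nonneg _) (by positivity) hp0,
      Real.mul_rpow (by positivity) (by positivity), hpow, ← div_eq_inv_mul,
      le_div_iff₀ (by positivity), hu.norm_sobolevEmb_toW0sub_rpow hpt, hu.norm_toW0sub_rpow hpt,
      mul_add, mul_one, hΛdef, Finset.mul_sum]
    gcongr with i
    rw [mul_comm]
    exact stripConst_mul_integral_le hab hp hu i
  · refine (Real.rpow_le_rpow_iff (by positivity)
      (norm_nonneg (SobolevEmb p (stripDomain n k a b))) hp0).1 ?_
    rw [hpow, inv_le_iff_one_le_mul₀ (by positivity)]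
    set M := ‖SobolevEmb p (stripDomain n k a b)‖ ^ p.toReal
    have hM : 0 ≤ M := by positivity
    have hδ : ∀ δ > 0, 1 ≤ M * (1 + Λ) + M * n * δ := fun δ hδ => by
      obtain ⟨u, hu, hA, hB⟩ := exists_isTestFun_integral_pder_le hab hp hδ
      have h1 := Real.rpow_le_rpow (norm_nonneg _)
        ((SobolevEmb p (stripDomain n k a b)).le_opNorm (hu.toW0sub p)) hp0.le
      rw [Real.mul_rpow (norm_nonneg (SobolevEmb p (stripDomain n k a b))) (norm_nonneg _),
        hu.norm_sobolevEmb_toW0sub_rpow hpt, hu.norm_toW0sub_rpow hpt] at h1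
      set A := ∫ x, |u x| ^ p.toReal
      have h2 : ∑ i, ∫ x, |pder i u x| ^ p.toReal ≤ (Λ + n * δ) * A := by
        refine (Finset.sum_le_sum fun i _ => hB i).trans_eq ?_
        rw [← Finset.sum_mul, Finset.sum_add_distrib]
        simp [hΛdef]
      have h3 : A * 1 ≤ A * (M * (1 + Λ) + M * n * δ) := by
        calc A * 1 ≤ M * (A + (Λ + n * δ) * A) := by
              rw [mul_one]; exact h1.trans (mul_le_mul_of_nonneg_left (by linarith) hM)
          _ = _ := by ring
      exact le_of_mul_le_mul_left h3 hA
    have hlim : Tendsto (fun δ : ℝ => M * (1 + Λ) + M * n * δ) (𝓝[>] 0) (𝓝 (M * (1 + Λ))) := by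
      have : Continuous fun δ : ℝ => M * (1 + Λ) + M * n * δ := by fun_prop
      simpa using (this.tendsto 0).mono_left nhdsWithin_le_nhds
    exact ge_of_tendsto hlim (eventually_mem_nhdsWithin.mono hδ)

/-- The canonical embedding `I_p : W₀^{1,p}(D) ↪ L^p(D)` on the strip-like
domain `D = ℝᵏ × ∏_{i=1}^{n-k} (aᵢ,bᵢ)` is maximally noncompact, and its measure of
noncompactness `β(I_p) = lim_m e_m(I_p)` equals
`‖I_p‖ = (1 + (p-1) (2π/(p sin(π/p)))^p ∑ (bᵢ-aᵢ)^{-p})^{-1/p}`. -/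
theorem measure_noncompactness_sobolevEmbedding_stripDomain
    (n k : ℕ) (hn : 2 ≤ n) (hk1 : 1 ≤ k) (hk : k < n) (p : ℝ) (hp : 1 < p)
    (a b : Fin n → ℝ) (hab : ∀ i : Fin n, k ≤ (i : ℕ) → a i < b i) :
    letI : Fact (1 ≤ ENNReal.ofReal p) := ⟨ENNReal.one_le_ofReal.mpr hp.le⟩
    Filter.Tendsto
        (fun m : ℕ => entropyNumber m (SobolevEmb (ENNReal.ofReal p) (stripDomain n k a b)))
        Filter.atTop
        (nhds ‖SobolevEmb (ENNReal.ofReal p) (stripDomain n k a b)‖) ∧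
      ‖SobolevEmb (ENNReal.ofReal p) (stripDomain n k a b)‖ =
        (1 + (p - 1) * (2 * Real.pi / (p * Real.sin (Real.pi / p))) ^ p *
          ∑ i ∈ Finset.univ.filter (fun i : Fin n => k ≤ (i : ℕ)), (b i - a i) ^ (-p)) ^ (-1 / p) := by
  have : Fact (1 ≤ ENNReal.ofReal p) := ⟨ENNReal.one_le_ofReal.mpr hp.le⟩
  have hpr : (ENNReal.ofReal p).toReal = p := ENNReal.toReal_ofReal (zero_le_one.trans hp.le)
  have hnorm := norm_sobolevEmb_stripDomain hab (p := ENNReal.ofReal p) (by rwa [hpr])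
    ENNReal.ofReal_ne_top
  rw [hpr] at hnorm
  have hpos : 0 < ‖SobolevEmb (ENNReal.ofReal p) (stripDomain n k a b)‖ := by
    have := Finset.sum_nonneg fun i (_ : i ∈ Finset.univ) => stripConst_nonneg hab hp i
    rw [hnorm]
    positivity
  refine ⟨?_, ?_⟩
  · simp_rw [entropyNumber_eq_norm hpos fun c _ hc =>
      norm_sobolevEmb_le_of_cover ENNReal.ofReal_ne_top (i₀ := ⟨0, by omega⟩)
        (Nat.lt_of_lt_of_le Nat.zero_lt_one hk1) c hc]
    exact tendsto_const_nhds
  · rw [hnorm, Finset.mul_sum, Finset.sum_filter]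
    rfl
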